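/- arXiv:math/0009182 — 2 statements merged into one kernel-verified Lean document; each statement's English description precedes it below -/
import Mathlib

section
/- Let q be a prime power and let c_A(∞,q) = [(1 − 1/q)/(1 − 1/q + 1/q^2)] · [(1 − 1/q^5)/(1 + 1/q^3)] denote the limit as n → ∞ of the proportion c_A(n,q) of cyclic elements of A(n,q). Then for every n ≥ 0, |c_A(∞,q) − c_A(n,q)| ≤ 1/(q^{n+1}(1 − 1/q)). -/
open Matrix

/-- Membership in the affine group `A(n,q)`: invertible `(n+1) × (n+1)` matrices with
`x_{11} = 1` and `x_{j1} = 0` for `j ≥ 2` (indices starting at `0` in Lean). -/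
def IsAff {F : Type} [Field F] {n : ℕ} (x : GL (Fin (n + 1)) F) : Prop :=
  x.val 0 0 = 1 ∧ ∀ j : Fin (n + 1), j ≠ 0 → x.val j 0 = 0

/-- `c_A(n,q)`: the proportion of cyclic elements (characteristic polynomial equal to the
minimal polynomial) of the affine group `A(n,q)`. -/
noncomputable def cA (F : Type) [Field F] [Fintype F] (n : ℕ) : ℝ :=
  (Nat.card {x : GL (Fin (n + 1)) F //
      IsAff x ∧ x.val.charpoly = minpoly F x.val} : ℝ) /
    (Nat.card {x : GL (Fin (n + 1)) F // IsAff x} : ℝ)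

open Polynomial

section CountingMatrices

variable {F : Type} [Field F]

theorem exists_linearEquiv_apply_eq {V : Type*} [AddCommGroup V] [Module F V]
    [FiniteDimensional F V] {v w : V} (hv : v ≠ 0) (hw : w ≠ 0) : ∃ e : V ≃ₗ[F] V, e v = w := by
  let f := (LinearEquiv.toSpanNonzeroSingleton F V v hv).symm ≪≫ₗ
    LinearEquiv.toSpanNonzeroSingleton F V w hw
  obtain ⟨g, hg⟩ := Submodule.exists_linearEquiv_restrict_eq f
  refine ⟨g, ?_⟩
  have h1 : (⟨v, Submodule.mem_span_singleton_self v⟩ : Submodule.span F {v}) =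
      LinearEquiv.toSpanNonzeroSingleton F V v hv 1 := by
    ext; simp
  have h := hg ⟨v, Submodule.mem_span_singleton_self v⟩
  have h2 : f ⟨v, Submodule.mem_span_singleton_self v⟩ =
      LinearEquiv.toSpanNonzeroSingleton F V w hw 1 := by
    rw [h1, LinearEquiv.trans_apply, LinearEquiv.symm_apply_apply]
  rw [h2] at h
  simpa using h.symm

theorem finrank_adjoinRoot {g : F[X]} (hg : g.Monic) :
    Module.finrank F (AdjoinRoot g) = g.natDegree := by
  rw [(AdjoinRoot.powerBasis' hg).finrank, AdjoinRoot.powerBasis'_dim]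

/-- The matrix of multiplication by the root of `g`, in the coordinates given by `P`. -/
noncomputable def rootMatrix {g : F[X]} {N : ℕ} (P : AdjoinRoot g ≃ₗ[F] (Fin N → F)) :
    Matrix (Fin N) (Fin N) F :=
  LinearMap.toMatrix' (P.conj (LinearMap.mulLeft F (AdjoinRoot.root g)))

theorem rootMatrix_mulVec {g : F[X]} {N : ℕ} (P : AdjoinRoot g ≃ₗ[F] (Fin N → F))
    (v : Fin N → F) : rootMatrix P *ᵥ v = P (AdjoinRoot.root g * P.symm v) := by
  simp [rootMatrix, LinearMap.toMatrix'_mulVec, LinearEquiv.conj_apply]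

theorem rootMatrix_eq_iff {g : F[X]} {N : ℕ} (P : AdjoinRoot g ≃ₗ[F] (Fin N → F))
    (M : Matrix (Fin N) (Fin N) F) :
    rootMatrix P = M ↔ ∀ a, P (AdjoinRoot.root g * a) = M *ᵥ P a := by
  constructor
  · rintro rfl a
    simp [rootMatrix_mulVec]
  · intro h
    refine Matrix.toLin'.injective (LinearMap.ext fun v => ?_)
    simpa [rootMatrix_mulVec] using h (P.symm v)

theorem minpoly_rootMatrix {g : F[X]} (hg : g.Monic) {N : ℕ}
    (P : AdjoinRoot g ≃ₗ[F] (Fin N → F)) : minpoly F (rootMatrix P) = g := by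
  rw [rootMatrix, LinearMap.minpoly_toMatrix']
  have h1 : minpoly F (P.conj (LinearMap.mulLeft F (AdjoinRoot.root g))) =
      minpoly F (LinearMap.mulLeft F (AdjoinRoot.root g)) :=
    minpoly.algEquiv_eq (P.conjAlgEquiv F) _
  have h2 : minpoly F (LinearMap.mulLeft F (AdjoinRoot.root g)) =
      minpoly F (AdjoinRoot.root g) :=
    minpoly.algHom_eq (Algebra.lmul F (AdjoinRoot g)) (Algebra.lmul_injective) _
  rw [h1, h2, AdjoinRoot.minpoly_root hg.ne_zero, hg.leadingCoeff]
  simp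

theorem charpoly_rootMatrix {g : F[X]} (hg : g.Monic) {N : ℕ} (hN : g.natDegree = N)
    (P : AdjoinRoot g ≃ₗ[F] (Fin N → F)) : (rootMatrix P).charpoly = g := by
  refine eq_of_monic_of_dvd_of_natDegree_le hg (Matrix.charpoly_monic _) ?_ ?_
  · have h := Matrix.minpoly_dvd_charpoly (rootMatrix P)
    rwa [minpoly_rootMatrix hg] at h
  · simp [Matrix.charpoly_natDegree_eq_dim, hN]

theorem exists_rootMatrix_eq {g : F[X]} (hg : g.Monic) {N : ℕ} (hN : g.natDegree = N)
    (M : Matrix (Fin N) (Fin N) F) (hM : minpoly F M = g) :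
    ∃ P : AdjoinRoot g ≃ₗ[F] (Fin N → F), rootMatrix P = M := by
  have hM' : minpoly F (Matrix.toLin' M) = g := by rw [Matrix.minpoly_toLin', hM]
  obtain ⟨y, hy⟩ := Module.exists_ker_toSpanSingleton_eq_annihilator F[X]
    (Module.AEval' (Matrix.toLin' M))
  obtain ⟨v, rfl⟩ := (Module.AEval'.of (Matrix.toLin' M)).surjective y
  have hker : ∀ p : F[X], aeval (Matrix.toLin' M) p v = 0 → g ∣ p := by
    intro p hp
    rw [← span_minpoly_eq_annihilator, hM'] at hy
    rw [← Ideal.mem_span_singleton, ← hy, LinearMap.mem_ker, LinearMap.toSpanSingleton_apply]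
    have h := Module.AEval.of_aeval_smul (R := F) (Matrix.toLin' M) p v
    rw [Module.End.smul_def, hp] at h
    exact h.symm.trans (map_zero _)
  let φ : AdjoinRoot g →ₐ[F] Module.End F (Fin N → F) :=
    Ideal.Quotient.liftₐ (Ideal.span {g}) (aeval (Matrix.toLin' M)) (by
      intro p hp
      obtain ⟨r, rfl⟩ := Ideal.mem_span_singleton.1 hp
      have := minpoly.aeval F (Matrix.toLin' M)
      rw [hM'] at this
      rw [map_mul, this, zero_mul])
  have hφ' : ∀ p, φ (AdjoinRoot.mk g p) = aeval (Matrix.toLin' M) p := fun p => rfl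
  have hφ : φ (AdjoinRoot.root g) = Matrix.toLin' M := by
    rw [← AdjoinRoot.mk_X, hφ', aeval_X]
  let f : AdjoinRoot g →ₗ[F] (Fin N → F) := (LinearMap.applyₗ v).comp φ.toLinearMap
  have hf : ∀ a, f a = φ a v := fun a => rfl
  have hinj : Function.Injective f := by
    rw [injective_iff_map_eq_zero]
    intro a
    obtain ⟨p, rfl⟩ := AdjoinRoot.mk_surjective a
    rw [hf, hφ', AdjoinRoot.mk_eq_zero]
    exact hker p
  have := hg.finite_adjoinRoot
  let P := LinearEquiv.ofInjectiveOfFinrankEq f hinj (by simp [finrank_adjoinRoot hg, hN])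
  refine ⟨P, (rootMatrix_eq_iff P M).2 fun a => ?_⟩
  change f _ = M *ᵥ f a
  rw [hf, hf, map_mul, hφ]
  simp

theorem nat_card_rootMatrix_fiber {g : F[X]} {N : ℕ} (P₀ : AdjoinRoot g ≃ₗ[F] (Fin N → F)) :
    Nat.card {P : AdjoinRoot g ≃ₗ[F] (Fin N → F) // rootMatrix P = rootMatrix P₀} =
      Nat.card (AdjoinRoot g)ˣ := by
  symm
  let m : (AdjoinRoot g)ˣ → (AdjoinRoot g ≃ₗ[F] AdjoinRoot g) := fun u =>
    LinearEquiv.ofLinearMap (LinearMap.mulLeft F (u : AdjoinRoot g))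
      (LinearMap.mulLeft F ((u⁻¹ : (AdjoinRoot g)ˣ) : AdjoinRoot g))
      (by ext; simp) (by ext; simp)
  have hm : ∀ u a, m u a = u * a := fun u a => rfl
  refine Nat.card_congr (Equiv.ofBijective (fun u => ⟨(m u).trans P₀, ?_⟩) ⟨?_, ?_⟩)
  · rw [rootMatrix_eq_iff]
    intro a
    simp only [LinearEquiv.trans_apply, hm, rootMatrix_mulVec, LinearEquiv.symm_apply_apply]
    rw [mul_left_comm]
  · intro u v h
    have h1 := LinearEquiv.congr_fun (congrArg Subtype.val h) 1
    simp only [LinearEquiv.trans_apply, hm, mul_one] at h1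
    exact Units.ext (P₀.injective h1)
  · rintro ⟨P, hP⟩
    rw [rootMatrix_eq_iff] at hP
    let e := P.trans P₀.symm
    have he : ∀ a, e (AdjoinRoot.root g * a) = AdjoinRoot.root g * e a := by
      intro a
      simp [e, hP, rootMatrix_mulVec]
    have he' : ∀ p : F[X], ∀ a, e (AdjoinRoot.mk g p * a) = AdjoinRoot.mk g p * e a := by
      intro p
      induction p using Polynomial.induction_on' with
      | add p r hp hr => intro a; simp [add_mul, hp, hr]
      | monomial n c =>
        intro a
        rw [← C_mul_X_pow_eq_monomial, map_mul (AdjoinRoot.mk g), map_pow, AdjoinRoot.mk_X,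
          AdjoinRoot.mk_C,
          mul_assoc, mul_assoc]
        have hc : ∀ b : AdjoinRoot g, AdjoinRoot.of g c * b = c • b := fun b => by
          rw [Algebra.smul_def, AdjoinRoot.algebraMap_eq]
        rw [hc, hc, map_smul]
        congr 1
        induction n with
        | zero => simp
        | succ n ih => rw [pow_succ', mul_assoc, he, ih, mul_assoc]
    have he1 : ∀ a, e a = a * e 1 := by
      intro a
      obtain ⟨p, rfl⟩ := AdjoinRoot.mk_surjective a
      simpa using he' p 1
    obtain ⟨b, hb⟩ := e.surjective 1
    rw [he1] at hb
    refine ⟨Units.mkOfMulEqOne (e 1) b (by rw [mul_comm, hb]), Subtype.ext ?_⟩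
    ext1 a
    simp only [LinearEquiv.trans_apply, hm]
    change P₀ (e 1 * a) = P a
    rw [mul_comm, ← he1]
    simp [e]

theorem isAff_iff {n : ℕ} (x : GL (Fin (n + 1)) F) :
    IsAff x ↔ x.val *ᵥ Pi.single 0 1 = Pi.single 0 1 := by
  rw [Matrix.mulVec_single_one]
  constructor
  · rintro ⟨h0, h⟩
    ext j
    by_cases hj : j = 0
    · subst hj; simpa using h0
    · simpa [hj] using h j hj
  · intro h
    refine ⟨by simpa using congrFun h 0, fun j hj => by simpa [hj] using congrFun h j⟩

/-- The linear automorphism of `F ^ N` given by an invertible matrix. -/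
noncomputable def glEquiv (N : ℕ) : GL (Fin N) F ≃ ((Fin N → F) ≃ₗ[F] (Fin N → F)) :=
  Matrix.GeneralLinearGroup.toLin.toEquiv.trans
    (LinearMap.GeneralLinearGroup.generalLinearEquiv F (Fin N → F)).toEquiv

theorem glEquiv_apply (N : ℕ) (x : GL (Fin N) F) (v : Fin N → F) :
    glEquiv N x v = x.val *ᵥ v := rfl

theorem nonempty_adjoinRoot_equiv {g : F[X]} (hg : g.Monic) {N : ℕ} (hN : g.natDegree = N) :
    Nonempty (AdjoinRoot g ≃ₗ[F] (Fin N → F)) := by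
  have := hg.finite_adjoinRoot
  exact FiniteDimensional.nonempty_linearEquiv_of_finrank_eq
    (by simp [finrank_adjoinRoot hg, hN])

theorem nat_card_adjoinRoot_equiv {g : F[X]} (hg : g.Monic) {N : ℕ} (hN : g.natDegree = N) :
    Nat.card (AdjoinRoot g ≃ₗ[F] (Fin N → F)) = Nat.card (GL (Fin N) F) := by
  obtain ⟨P₀⟩ := nonempty_adjoinRoot_equiv hg hN
  refine (Nat.card_congr ((glEquiv N).trans ?_)).symm
  exact ⟨fun e => P₀.trans e, fun P => P₀.symm.trans P,
    fun e => by ext1; simp, fun P => by ext1; simp⟩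

theorem nat_card_equiv_apply_eq {g : F[X]} (hg : g.Monic) {n : ℕ} (hN : g.natDegree = n + 1)
    {a : AdjoinRoot g} (ha : a ≠ 0) :
    Nat.card {P : AdjoinRoot g ≃ₗ[F] (Fin (n + 1) → F) // P a = Pi.single 0 1} =
      Nat.card {x : GL (Fin (n + 1)) F // IsAff x} := by
  obtain ⟨P₁⟩ := nonempty_adjoinRoot_equiv hg hN
  obtain ⟨e, he⟩ := exists_linearEquiv_apply_eq (F := F) (v := P₁ a)
    (w := (Pi.single 0 1 : Fin (n + 1) → F)) (by simpa using ha) (by simp)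
  obtain ⟨P₀, hP₀⟩ : ∃ P₀ : AdjoinRoot g ≃ₗ[F] (Fin (n + 1) → F), P₀ a = Pi.single 0 1 :=
    ⟨P₁.trans e, by simpa using he⟩
  symm
  let E : GL (Fin (n + 1)) F ≃ (AdjoinRoot g ≃ₗ[F] (Fin (n + 1) → F)) :=
    (glEquiv (n + 1)).trans ⟨fun e => P₀.trans e, fun P => P₀.symm.trans P,
    fun e => by ext1; simp, fun P => by ext1; simp⟩
  refine Nat.card_congr (E.subtypeEquiv fun x => ?_)
  rw [isAff_iff]
  change _ ↔ glEquiv (n + 1) x (P₀ a) = _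
  rw [hP₀, glEquiv_apply]

theorem X_sub_one_dvd_charpoly {n : ℕ} {M : Matrix (Fin (n + 1)) (Fin (n + 1)) F}
    (hM : M *ᵥ Pi.single 0 1 = Pi.single 0 1) : X - 1 ∣ M.charpoly := by
  rw [← C_1, dvd_iff_isRoot, IsRoot.def, Matrix.eval_charpoly,
    ← Matrix.exists_mulVec_eq_zero_iff]
  exact ⟨Pi.single 0 1, by simp, by
    rw [Matrix.sub_mulVec, hM, Matrix.scalar_apply, Matrix.diagonal_one, Matrix.one_mulVec,
    sub_self]⟩

variable [Fintype F]

theorem nat_card_subtype_rootMatrix {g : F[X]} (hg : g.Monic) {N : ℕ} (hN : g.natDegree = N)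
    (Q : Matrix (Fin N) (Fin N) F → Prop) :
    Nat.card {P : AdjoinRoot g ≃ₗ[F] (Fin N → F) // Q (rootMatrix P)} =
      Nat.card {M : Matrix (Fin N) (Fin N) F // M.charpoly = g ∧ minpoly F M = g ∧ Q M} *
        Nat.card (AdjoinRoot g)ˣ := by
  have := hg.finite_adjoinRoot
  have : Finite (AdjoinRoot g) := Module.finite_of_finite F
  have : Finite (AdjoinRoot g ≃ₗ[F] (Fin N → F)) := DFunLike.finite _
  let S := {M : Matrix (Fin N) (Fin N) F // M.charpoly = g ∧ minpoly F M = g ∧ Q M}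
  have : Fintype S := Fintype.ofFinite S
  let e : {P : AdjoinRoot g ≃ₗ[F] (Fin N → F) // Q (rootMatrix P)} ≃
      Σ M : S, {P : AdjoinRoot g ≃ₗ[F] (Fin N → F) // rootMatrix P = M.1} :=
    { toFun := fun P => ⟨⟨rootMatrix P.1, charpoly_rootMatrix hg hN P.1,
        minpoly_rootMatrix hg P.1, P.2⟩, P.1, rfl⟩
      invFun := fun x => ⟨x.2.1, by rw [x.2.2]; exact x.1.2.2.2⟩
      left_inv := fun P => rfl
      right_inv := by
        rintro ⟨⟨M, hM⟩, P, hP⟩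
        dsimp only at hP
        subst hP
        rfl }
  rw [Nat.card_congr e, Nat.card_sigma]
  have : ∀ M : S, Nat.card {P : AdjoinRoot g ≃ₗ[F] (Fin N → F) // rootMatrix P = M.1} =
      Nat.card (AdjoinRoot g)ˣ := by
    intro M
    obtain ⟨P₀, hP₀⟩ := exists_rootMatrix_eq hg hN M.1 M.2.2.1
    rw [← hP₀, nat_card_rootMatrix_fiber]
  simp [this, S]

theorem nat_card_fixed_by_root {k : F[X]} (hk : k.Monic) :
    Nat.card {a : AdjoinRoot ((X - 1) * k) // a ≠ 0 ∧ AdjoinRoot.root ((X - 1) * k) * a = a} =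
      Fintype.card F - 1 := by
  set g := (X - 1) * k with hg
  have hX : (X - 1 : F[X]).Monic := by simpa using monic_X_sub_C (1 : F)
  have hsmul : ∀ c : F, c ≠ 0 → AdjoinRoot.mk g (C c * k) ≠ 0 := by
    intro c hc h
    rw [AdjoinRoot.mk_eq_zero] at h
    have h1 := natDegree_le_of_dvd h (mul_ne_zero (by simpa using hc) hk.ne_zero)
    rw [natDegree_C_mul hc, hg, hX.natDegree_mul hk] at h1
    have : (X - 1 : F[X]).natDegree = 1 := by simpa using natDegree_X_sub_C (1 : F)
    omega
  have hcard : Nat.card {c : F // c ≠ 0} = Fintype.card F - 1 := by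
    classical
    rw [Nat.card_eq_fintype_card, Fintype.card_subtype_compl, Fintype.card_subtype_eq]
  rw [← hcard]
  symm
  refine Nat.card_congr (Equiv.ofBijective
    (fun c => ⟨AdjoinRoot.mk g (C c.1 * k), hsmul c.1 c.2, ?_⟩) ⟨?_, ?_⟩)
  · rw [← AdjoinRoot.mk_X, ← map_mul, ← sub_eq_zero, ← map_sub, AdjoinRoot.mk_eq_zero]
    exact ⟨C c.1, by rw [hg]; ring⟩
  · rintro ⟨c, hc⟩ ⟨d, hd⟩ h
    have h1 : AdjoinRoot.mk g (C c * k) = AdjoinRoot.mk g (C d * k) := congrArg Subtype.val h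
    rw [← sub_eq_zero, ← map_sub, ← sub_mul, ← C_sub] at h1
    by_contra hne
    exact hsmul (c - d) (sub_ne_zero.2 fun h => hne (Subtype.ext h)) h1
  · rintro ⟨a, ha, hra⟩
    obtain ⟨p, rfl⟩ := AdjoinRoot.mk_surjective a
    rw [← AdjoinRoot.mk_X, ← map_mul, ← sub_eq_zero, ← map_sub, AdjoinRoot.mk_eq_zero,
      ← sub_one_mul, hg] at hra
    obtain ⟨h, rfl⟩ := (mul_dvd_mul_iff_left hX.ne_zero).1 hra
    have key : AdjoinRoot.mk g (C (h.eval 1) * k) = AdjoinRoot.mk g (k * h) := by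
      rw [← sub_eq_zero, ← map_sub, AdjoinRoot.mk_eq_zero]
      obtain ⟨r, hr⟩ : X - 1 ∣ h - C (h.eval 1) := by
        have := X_sub_C_dvd_sub_C_eval (a := (1 : F)) (p := h)
        simpa using this
      rw [mul_comm k h, ← sub_mul, ← neg_sub, hr]
      exact ⟨-r, by rw [hg]; ring⟩
    refine ⟨⟨h.eval 1, fun h0 => ha ?_⟩, Subtype.ext key⟩
    rw [← key, h0]
    simp

theorem nat_card_equiv_fixing {k : F[X]} (hk : k.Monic) {n : ℕ} (hn : k.natDegree = n) :
    Nat.card {P : AdjoinRoot ((X - 1) * k) ≃ₗ[F] (Fin (n + 1) → F) //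
        rootMatrix P *ᵥ Pi.single 0 1 = Pi.single 0 1} =
      (Fintype.card F - 1) * Nat.card {x : GL (Fin (n + 1)) F // IsAff x} := by
  have hX : (X - 1 : F[X]).Monic := by simpa using monic_X_sub_C (1 : F)
  have hX1 : (X - 1 : F[X]).natDegree = 1 := by simpa using natDegree_X_sub_C (1 : F)
  have hg : ((X - 1) * k).Monic := hX.mul hk
  have hN : ((X - 1) * k).natDegree = n + 1 := by
    rw [hX.natDegree_mul hk, hX1, hn, add_comm]
  have hfix := nat_card_fixed_by_root hk
  generalize (X - 1) * k = g at *
  have := hg.finite_adjoinRoot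
  have : Finite (AdjoinRoot g) := Module.finite_of_finite F
  have : Finite (AdjoinRoot g ≃ₗ[F] (Fin (n + 1) → F)) := DFunLike.finite _
  let S := {a : AdjoinRoot g // a ≠ 0 ∧ AdjoinRoot.root g * a = a}
  have : Fintype S := Fintype.ofFinite S
  let e : {P : AdjoinRoot g ≃ₗ[F] (Fin (n + 1) → F) //
        rootMatrix P *ᵥ Pi.single 0 1 = Pi.single 0 1} ≃
      Σ a : S, {P : AdjoinRoot g ≃ₗ[F] (Fin (n + 1) → F) // P a.1 = Pi.single 0 1} :=
    { toFun := fun P => ⟨⟨P.1.symm (Pi.single 0 1), by simp, by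
          have h := P.2
          rwa [rootMatrix_mulVec, ← LinearEquiv.eq_symm_apply] at h⟩, P.1, by simp⟩
      invFun := fun x => ⟨x.2.1, by
        have h : x.2.1.symm (Pi.single 0 1) = x.1.1 := by
          rw [LinearEquiv.symm_apply_eq, x.2.2]
        rw [rootMatrix_mulVec, h, x.1.2.2, x.2.2]⟩
      left_inv := fun P => rfl
      right_inv := by
        rintro ⟨⟨a, ha⟩, P, hP⟩
        dsimp only at hP
        obtain rfl : a = P.symm (Pi.single 0 1) := by rw [← hP]; simp
        rfl }
  rw [Nat.card_congr e, Nat.card_sigma, Finset.sum_congr rfl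
    (fun a _ => nat_card_equiv_apply_eq hg hN a.2.1), Finset.sum_const, Finset.card_univ,
    smul_eq_mul, ← Nat.card_eq_fintype_card, hfix]

theorem finite_monic_natDegree_eq (n : ℕ) : {p : F[X] | p.Monic ∧ p.natDegree = n}.Finite :=
  Set.finite_coe_iff.1 (Finite.of_equiv (Fin n → F)
    ((monicEquivDegreeLT n).trans (degreeLTEquiv F n).toEquiv).symm)

/-- The monic polynomials of degree `n` over a finite field. -/
noncomputable def monics (F : Type) [Field F] [Fintype F] (n : ℕ) : Finset F[X] :=
  (finite_monic_natDegree_eq n).toFinset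

theorem mem_monics {n : ℕ} {p : F[X]} : p ∈ monics F n ↔ p.Monic ∧ p.natDegree = n := by
  simp [monics]

theorem card_monics (n : ℕ) : (monics F n).card = Fintype.card F ^ n := by
  have h := Nat.card_congr ((monicEquivDegreeLT (R := F) n).trans (degreeLTEquiv F n).toEquiv)
  rw [monics, ← Set.ncard_eq_toFinset_card _ (finite_monic_natDegree_eq n),
    ← Nat.card_coe_set_eq]
  refine h.trans ?_
  simp

theorem nat_card_units_adjoinRoot_pos {g : F[X]} (hg : g.Monic) :
    0 < Nat.card (AdjoinRoot g)ˣ := by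
  have := hg.finite_adjoinRoot
  have : Finite (AdjoinRoot g) := Module.finite_of_finite F
  exact Nat.card_pos

open Classical in
theorem sum_one_div_nat_card_units_le_one (n : ℕ) :
    ∑ k ∈ monics F n with ¬ X ∣ k, (1 : ℝ) / Nat.card (AdjoinRoot k)ˣ ≤ 1 := by
  have hGL : (0 : ℝ) < Nat.card (GL (Fin n) F) := by exact_mod_cast Nat.card_pos
  let T : F[X] → Type := fun g =>
    {M : Matrix (Fin n) (Fin n) F // M.charpoly = g ∧ minpoly F M = g ∧ True}
  have hT : ∀ g : F[X], g ∈ (monics F n).filter (fun k => ¬ X ∣ k) →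
      (1 : ℝ) / Nat.card (AdjoinRoot g)ˣ = Nat.card (T g) / Nat.card (GL (Fin n) F) := by
    intro g hg
    obtain ⟨hg, hn⟩ := mem_monics.1 (Finset.mem_filter.1 hg).1
    have h := nat_card_subtype_rootMatrix hg hn (fun _ => True)
    rw [Nat.card_congr (Equiv.subtypeUnivEquiv (fun _ => trivial)),
      nat_card_adjoinRoot_equiv hg hn] at h
    have hpos : (0 : ℝ) < Nat.card (AdjoinRoot g)ˣ := by
      exact_mod_cast nat_card_units_adjoinRoot_pos hg
    rw [div_eq_div_iff hpos.ne' hGL.ne', one_mul]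
    exact_mod_cast h
  rw [Finset.sum_congr rfl hT, ← Finset.sum_div, div_le_one hGL]
  norm_cast
  rw [← Finset.sum_coe_sort, ← Nat.card_sigma]
  have hunit : ∀ (g : F[X]) (M : Matrix (Fin n) (Fin n) F),
      g ∈ (monics F n).filter (fun k => ¬ X ∣ k) → M.charpoly = g → IsUnit M := by
    rintro g M hg rfl
    have h := (Finset.mem_filter.1 hg).2
    rw [X_dvd_iff] at h
    rw [Matrix.isUnit_iff_isUnit_det, isUnit_iff_ne_zero, Matrix.det_eq_sign_charpoly_coeff]
    exact mul_ne_zero (by simp) h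
  refine Nat.card_le_card_of_injective
    (fun x : (Σ g : ((monics F n).filter (fun k => ¬ X ∣ k) : Finset F[X]), T g) =>
      (hunit x.1 x.2.1 x.1.2 x.2.2.1).unit) ?_
  rintro ⟨⟨g, hg⟩, M, hM⟩ ⟨⟨g', hg'⟩, M', hM'⟩ h
  obtain rfl : M = M' := congrArg Units.val h
  obtain rfl : g = g' := hM.1.symm.trans hM'.1
  rfl

open Classical in
theorem cA_eq_sum (n : ℕ) :
    cA F n = ∑ k ∈ monics F n with ¬ X ∣ k,
      ((Fintype.card F : ℝ) - 1) / Nat.card (AdjoinRoot ((X - 1) * k))ˣ := by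
  have hX : (X - 1 : F[X]).Monic := by simpa using monic_X_sub_C (1 : F)
  have hX1 : (X - 1 : F[X]).natDegree = 1 := by simpa using natDegree_X_sub_C (1 : F)
  have hX0 : ¬ (X : F[X]) ∣ X - 1 := by rw [X_dvd_iff]; simp
  have hone : IsAff (1 : GL (Fin (n + 1)) F) := by rw [isAff_iff, Units.val_one, Matrix.one_mulVec]
  have : Nonempty {x : GL (Fin (n + 1)) F // IsAff x} := ⟨1, hone⟩
  have hA : (0 : ℝ) < Nat.card {x : GL (Fin (n + 1)) F // IsAff x} := by
    exact_mod_cast Nat.card_pos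
  have hq : 1 ≤ Fintype.card F := Fintype.card_pos
  let T : F[X] → Type := fun k =>
    {M : Matrix (Fin (n + 1)) (Fin (n + 1)) F // M.charpoly = (X - 1) * k ∧
      minpoly F M = (X - 1) * k ∧ M *ᵥ Pi.single 0 1 = Pi.single 0 1}
  have hT : ∀ k : F[X], k ∈ (monics F n).filter (fun k => ¬ X ∣ k) →
      ((Fintype.card F : ℝ) - 1) / Nat.card (AdjoinRoot ((X - 1) * k))ˣ =
        Nat.card (T k) / Nat.card {x : GL (Fin (n + 1)) F // IsAff x} := by
    intro k hk
    obtain ⟨hk, hn⟩ := mem_monics.1 (Finset.mem_filter.1 hk).1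
    have h := nat_card_subtype_rootMatrix (hX.mul hk)
      (by rw [hX.natDegree_mul hk, hX1, hn, add_comm])
      (fun M : Matrix (Fin (n + 1)) (Fin (n + 1)) F => M *ᵥ Pi.single 0 1 = Pi.single 0 1)
    rw [nat_card_equiv_fixing hk hn] at h
    have hpos : (0 : ℝ) < Nat.card (AdjoinRoot ((X - 1) * k))ˣ := by
      exact_mod_cast nat_card_units_adjoinRoot_pos (hX.mul hk)
    rw [div_eq_div_iff hpos.ne' hA.ne', ← Nat.cast_one, ← Nat.cast_sub hq]
    exact_mod_cast h
  rw [Finset.sum_congr rfl hT, ← Finset.sum_div, cA]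
  congr 1
  norm_cast
  rw [← Finset.sum_coe_sort, ← Nat.card_sigma]
  symm
  have hunit : ∀ (k : F[X]) (M : Matrix (Fin (n + 1)) (Fin (n + 1)) F),
      k ∈ (monics F n).filter (fun k => ¬ X ∣ k) → M.charpoly = (X - 1) * k → IsUnit M := by
    intro k M hk hM
    have h : ¬ X ∣ M.charpoly := by
      rw [hM, prime_X.dvd_mul, not_or]
      exact ⟨hX0, (Finset.mem_filter.1 hk).2⟩
    rw [X_dvd_iff] at h
    rw [Matrix.isUnit_iff_isUnit_det, isUnit_iff_ne_zero, Matrix.det_eq_sign_charpoly_coeff]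
    exact mul_ne_zero (by simp) h
  refine Nat.card_congr (Equiv.ofBijective
    (fun x : (Σ k : ((monics F n).filter (fun k => ¬ X ∣ k) : Finset F[X]), T k) =>
      ⟨(hunit x.1 x.2.1 x.1.2 x.2.2.1).unit, (isAff_iff _).2 x.2.2.2.2,
        x.2.2.1.trans x.2.2.2.1.symm⟩) ⟨?_, ?_⟩)
  · rintro ⟨⟨g, hg⟩, M, hM⟩ ⟨⟨g', hg'⟩, M', hM'⟩ h
    obtain rfl : M = M' := congrArg (fun y => y.1.val) h
    obtain rfl : g = g' := mul_left_cancel₀ hX.ne_zero (hM.1.symm.trans hM'.1)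
    rfl
  · rintro ⟨x, hx, hcyc⟩
    rw [isAff_iff] at hx
    obtain ⟨k, hk⟩ := X_sub_one_dvd_charpoly hx
    have hk1 : k.Monic := hX.of_mul_monic_left (by rw [← hk]; exact Matrix.charpoly_monic _)
    have hkn : k.natDegree = n := by
      have h := Matrix.charpoly_natDegree_eq_dim x.val
      rw [hk, hX.natDegree_mul hk1, hX1, Fintype.card_fin] at h
      omega
    have hk0 : ¬ X ∣ k := by
      intro hdvd
      have h : X ∣ x.val.charpoly := by rw [hk]; exact hdvd.mul_left _
      rw [X_dvd_iff] at h
      have hdet := Matrix.det_eq_sign_charpoly_coeff x.val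
      rw [h, mul_zero] at hdet
      exact ((Matrix.isUnit_iff_isUnit_det _).1 x.isUnit).ne_zero hdet
    exact ⟨⟨⟨k, Finset.mem_filter.2 ⟨mem_monics.2 ⟨hk1, hkn⟩, hk0⟩⟩, x.val, hk,
      hcyc ▸ hk, hx⟩, Subtype.ext (Units.ext rfl)⟩

end CountingMatrices

section Sieve

/-- The monic irreducible polynomials over a field. -/
abbrev MonicIrr (F : Type) [Field F] : Type := {P : F[X] // P.Monic ∧ Irreducible P}

variable {F : Type} [Field F]

theorem MonicIrr.prime (P : MonicIrr F) : Prime P.1 := P.2.2.prime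

theorem MonicIrr.natDegree_pos (P : MonicIrr F) : 0 < P.1.natDegree := P.2.2.natDegree_pos

theorem MonicIrr.eq_of_dvd {P Q : MonicIrr F} (h : P.1 ∣ Q.1) : P = Q :=
  Subtype.ext (eq_of_monic_of_associated P.2.1 Q.2.1 (P.2.2.associated_of_dvd Q.2.2 h))

theorem MonicIrr.dvd_mul_iff_of_ne {P Q : MonicIrr F} (h : Q ≠ P) (a : F[X]) :
    Q.1 ∣ P.1 * a ↔ Q.1 ∣ a := by
  rw [Q.prime.dvd_mul]
  exact ⟨fun h' => h'.resolve_left fun h'' => h (MonicIrr.eq_of_dvd h''), Or.inr⟩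

theorem exists_monicIrr_dvd {z : F[X]} (hz : Irreducible z) : ∃ P : MonicIrr F, P.1 ∣ z := by
  have hc : IsUnit (C z.leadingCoeff⁻¹) := by
    simpa using hz.ne_zero
  have h : Associated z (z * C z.leadingCoeff⁻¹) := associated_mul_unit_right z _ hc
  exact ⟨⟨_, monic_mul_leadingCoeff_inv hz.ne_zero, h.irreducible hz⟩, h.dvd'⟩

theorem isUnit_mk_iff {g : F[X]} (hg : g.Monic) (p : F[X]) :
    IsUnit (AdjoinRoot.mk g p) ↔ ∀ P : MonicIrr F, P.1 ∣ g → ¬ P.1 ∣ p := by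
  have h1 : IsUnit (AdjoinRoot.mk g p) ↔ IsCoprime p g := by
    rw [isUnit_iff_exists_inv]
    constructor
    · rintro ⟨b, hb⟩
      obtain ⟨r, rfl⟩ := AdjoinRoot.mk_surjective b
      rw [← map_mul, ← map_one (AdjoinRoot.mk g), ← sub_eq_zero, ← map_sub,
        AdjoinRoot.mk_eq_zero] at hb
      obtain ⟨t, ht⟩ := hb
      exact ⟨r, -t, by linear_combination ht⟩
    · rintro ⟨r, t, h⟩
      refine ⟨AdjoinRoot.mk g r, ?_⟩
      rw [← map_mul, ← map_one (AdjoinRoot.mk g), ← sub_eq_zero, ← map_sub,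
        AdjoinRoot.mk_eq_zero]
      exact ⟨-t, by linear_combination h⟩
  rw [h1]
  constructor
  · intro h P hPg hPp
    exact P.2.2.not_isUnit (h.isUnit_of_dvd' hPp hPg)
  · intro h
    refine isCoprime_of_irreducible_dvd (fun h0 => hg.ne_zero h0.2) fun z hz hzp hzg => ?_
    obtain ⟨P, hP⟩ := exists_monicIrr_dvd hz
    exact h P (hP.trans hzg) (hP.trans hzp)

theorem prod_monicIrr_dvd_iff {g : F[X]} (S : Finset (MonicIrr F)) :
    ∏ P ∈ S, P.1 ∣ g ↔ ∀ P ∈ S, P.1 ∣ g := by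
  refine ⟨fun h P hP => (Finset.dvd_prod_of_mem _ hP).trans h, fun h => ?_⟩
  refine Finset.prod_dvd_of_coprime ?_ h
  intro P _ Q _ hPQ
  exact (P.2.2.coprime_iff_not_dvd).2 fun h => hPQ (MonicIrr.eq_of_dvd h)

theorem monic_prod_monicIrr (S : Finset (MonicIrr F)) : (∏ P ∈ S, P.1).Monic :=
  monic_prod_of_monic _ _ fun P _ => P.2.1

theorem natDegree_prod_monicIrr (S : Finset (MonicIrr F)) :
    (∏ P ∈ S, P.1).natDegree = ∑ P ∈ S, P.1.natDegree :=
  natDegree_prod_of_monic _ _ fun P _ => P.2.1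

/-- The monic irreducible polynomial `X`. -/
noncomputable def MonicIrr.X (F : Type) [Field F] : MonicIrr F :=
  ⟨Polynomial.X, monic_X, irreducible_X⟩

/-- The monic irreducible polynomial `X - 1`. -/
noncomputable def MonicIrr.XSubOne (F : Type) [Field F] : MonicIrr F :=
  ⟨Polynomial.X - 1, monic_X_sub_C 1, irreducible_X_sub_C 1⟩

theorem MonicIrr.X_ne_XSubOne : MonicIrr.X F ≠ MonicIrr.XSubOne F := fun h => by
  simpa [MonicIrr.X, MonicIrr.XSubOne] using congrArg (fun P => P.1.eval 0) h

theorem MonicIrr.natDegree_X : (MonicIrr.X F).1.natDegree = 1 := Polynomial.natDegree_X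

theorem MonicIrr.natDegree_XSubOne : (MonicIrr.XSubOne F).1.natDegree = 1 :=
  natDegree_X_sub_C 1

variable [Fintype F]

/-- The polynomials of degree less than `n` over a finite field. -/
noncomputable def polysLT (F : Type) [Field F] [Fintype F] (n : ℕ) : Finset F[X] :=
  (Set.finite_coe_iff.1 (Finite.of_equiv (Fin n → F) (degreeLTEquiv F n).toEquiv.symm) :
    (degreeLT F n : Set F[X]).Finite).toFinset

theorem mem_polysLT {n : ℕ} {p : F[X]} : p ∈ polysLT F n ↔ p.degree < n := by
  simp [polysLT, mem_degreeLT]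

theorem card_polysLT (n : ℕ) : (polysLT F n).card = Fintype.card F ^ n := by
  have h := Nat.card_congr (degreeLTEquiv F n).toEquiv
  rw [polysLT, ← Set.ncard_eq_toFinset_card _ (Set.finite_coe_iff.1
    (Finite.of_equiv (Fin n → F) (degreeLTEquiv F n).toEquiv.symm)), ← Nat.card_coe_set_eq]
  refine h.trans ?_
  simp

open Classical in
theorem card_polysLT_sieve (S : Finset (MonicIrr F)) (n : ℕ) (hn : ∑ P ∈ S, P.1.natDegree ≤ n) :
    (((polysLT F n).filter fun a => ∀ P ∈ S, ¬ P.1 ∣ a).card : ℝ) =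
      (Fintype.card F : ℝ) ^ n *
        ∏ P ∈ S, (1 - ((Fintype.card F : ℝ)⁻¹) ^ P.1.natDegree) := by
  have hq : (Fintype.card F : ℝ) ≠ 0 := by exact_mod_cast Fintype.card_ne_zero
  induction S using Finset.induction_on generalizing n with
  | empty => simp [card_polysLT]
  | insert P S hP ih =>
    rw [Finset.sum_insert hP] at hn
    have h1 := ih n (by omega)
    have h2 := ih (n - P.1.natDegree) (by omega)
    have hdeg : ∀ b : F[X], (P.1 * b).degree < n ↔
        b.degree < (n - P.1.natDegree : ℕ) := by
      intro b
      by_cases hb : b = 0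
      · simp [hb]
      · rw [← natDegree_lt_iff_degree_lt (mul_ne_zero P.2.1.ne_zero hb),
          ← natDegree_lt_iff_degree_lt hb, natDegree_mul P.2.1.ne_zero hb]
        omega
    have h3 : ((polysLT F n).filter fun a => (∀ Q ∈ S, ¬ Q.1 ∣ a) ∧ P.1 ∣ a).card =
        ((polysLT F (n - P.1.natDegree)).filter fun a => ∀ Q ∈ S, ¬ Q.1 ∣ a).card := by
      symm
      refine Finset.card_bij (fun b _ => P.1 * b) ?_ ?_ ?_
      · intro b hb
        rw [Finset.mem_filter, mem_polysLT] at hb ⊢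
        exact ⟨(hdeg b).2 hb.1, fun Q hQ => (MonicIrr.dvd_mul_iff_of_ne
          (ne_of_mem_of_not_mem hQ hP) b).not.2 (hb.2 Q hQ), dvd_mul_right _ _⟩
      · intro a _ b _ h
        exact mul_left_cancel₀ P.2.1.ne_zero h
      · intro a ha
        rw [Finset.mem_filter, mem_polysLT] at ha
        obtain ⟨ha1, ha2, b, rfl⟩ := ha
        refine ⟨b, ?_, rfl⟩
        rw [Finset.mem_filter, mem_polysLT]
        exact ⟨(hdeg b).1 ha1, fun Q hQ => (MonicIrr.dvd_mul_iff_of_ne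
          (ne_of_mem_of_not_mem hQ hP) b).not.1 (ha2 Q hQ)⟩
    have h4 := Finset.card_filter_add_card_filter_not
      (s := (polysLT F n).filter fun a => ∀ Q ∈ S, ¬ Q.1 ∣ a) (fun a => P.1 ∣ a)
    rw [Finset.filter_filter, Finset.filter_filter, h3] at h4
    have h5 : ((polysLT F n).filter fun a => ∀ Q ∈ insert P S, ¬ Q.1 ∣ a) =
        (polysLT F n).filter fun a => (∀ Q ∈ S, ¬ Q.1 ∣ a) ∧ ¬ P.1 ∣ a := by
      ext a
      simp only [Finset.mem_filter, Finset.forall_mem_insert]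
      tauto
    have h6 := congrArg (Nat.cast (R := ℝ)) h4
    push_cast at h6
    rw [h1, h2] at h6
    have h7 : (Fintype.card F : ℝ) ^ n = (Fintype.card F : ℝ) ^ (n - P.1.natDegree) *
        (Fintype.card F : ℝ) ^ P.1.natDegree := by
      rw [← pow_add]; congr 1; omega
    rw [h5, Finset.prod_insert hP, eq_sub_of_add_eq' h6, inv_pow, h7]
    field_simp

theorem finite_monicIrr_dvd {g : F[X]} (hg : g.Monic) : {P : MonicIrr F | P.1 ∣ g}.Finite := by
  refine Set.Finite.of_injOn (f := Subtype.val) (t := (polysLT F (g.natDegree + 1) : Set F[X]))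
    ?_ Subtype.val_injective.injOn (Finset.finite_toSet _)
  intro P hP
  rw [Finset.mem_coe, mem_polysLT, degree_lt_iff_coeff_zero]
  intro m hm
  exact coeff_eq_zero_of_natDegree_lt
    (lt_of_le_of_lt (natDegree_le_of_dvd hP hg.ne_zero) (by omega))

open Classical in
/-- The monic irreducible divisors of a monic polynomial. -/
noncomputable def irrDivisors (g : F[X]) : Finset (MonicIrr F) :=
  if hg : g.Monic then (finite_monicIrr_dvd hg).toFinset else ∅

theorem mem_irrDivisors {g : F[X]} (hg : g.Monic) {P : MonicIrr F} :
    P ∈ irrDivisors g ↔ P.1 ∣ g := by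
  simp [irrDivisors, hg]

theorem nat_card_units_adjoinRoot {g : F[X]} (hg : g.Monic) :
    (Nat.card (AdjoinRoot g)ˣ : ℝ) = (Fintype.card F : ℝ) ^ g.natDegree *
      ∏ P ∈ irrDivisors g, (1 - ((Fintype.card F : ℝ)⁻¹) ^ P.1.natDegree) := by
  classical
  rw [← card_polysLT_sieve]
  · norm_cast
    rw [← Nat.card_eq_finsetCard]
    have hcop : ∀ p : F[X], IsUnit (AdjoinRoot.mk g p) ↔ ∀ P ∈ irrDivisors g, ¬ P.1 ∣ p := by
      intro p
      rw [isUnit_mk_iff hg]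
      exact forall_congr' fun P => by rw [mem_irrDivisors hg]
    symm
    refine Nat.card_congr (Equiv.ofBijective
      (fun p : ((polysLT F g.natDegree).filter fun a => ∀ P ∈ irrDivisors g, ¬ P.1 ∣ a :
        Finset F[X]) => ((hcop p.1).2 (Finset.mem_filter.1 p.2).2).unit) ⟨?_, ?_⟩)
    · rintro ⟨p, hp⟩ ⟨r, hr⟩ h
      have h1 : AdjoinRoot.mk g p = AdjoinRoot.mk g r := congrArg Units.val h
      rw [← sub_eq_zero, ← map_sub, AdjoinRoot.mk_eq_zero] at h1
      refine Subtype.ext (sub_eq_zero.1 (eq_zero_of_dvd_of_degree_lt h1 ?_))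
      rw [degree_eq_natDegree hg.ne_zero]
      exact lt_of_le_of_lt (degree_sub_le _ _)
        (max_lt (mem_polysLT.1 (Finset.mem_filter.1 hp).1)
          (mem_polysLT.1 (Finset.mem_filter.1 hr).1))
    · intro u
      obtain ⟨p, hp⟩ := AdjoinRoot.mk_surjective u.val
      have h1 : AdjoinRoot.mk g (p %ₘ g) = u := by
        rw [← hp, ← sub_eq_zero, ← map_sub, AdjoinRoot.mk_eq_zero]
        exact ⟨-(p /ₘ g), by linear_combination modByMonic_add_div p g⟩
      refine ⟨⟨p %ₘ g, Finset.mem_filter.2 ⟨mem_polysLT.2 ?_, (hcop _).1 ?_⟩⟩, Units.ext h1⟩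
      · rw [← degree_eq_natDegree hg.ne_zero]
        exact degree_modByMonic_lt p hg
      · rw [h1]; exact u.isUnit
  · rw [← natDegree_prod_monicIrr]
    exact natDegree_le_of_dvd ((prod_monicIrr_dvd_iff _).2 fun P hP => (mem_irrDivisors hg).1 hP)
      hg.ne_zero

open Filter Topology

theorem hasSum_of_hasSum_fibers {α : Type*} (d : α → ℕ) (B : ℕ → Finset α)
    (hB : ∀ a n, a ∈ B n ↔ d a = n) {f : α → ℝ} (hf : ∀ a, 0 ≤ f a) {c : ℝ}
    (h : HasSum (fun n => ∑ a ∈ B n, f a) c) : HasSum f c := by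
  have hfib : ∀ n, HasSum (fun a : {a // d a = n} => f a) (∑ a ∈ B n, f a) := by
    intro n
    have h1 : ∀ a, a ∈ B n ↔ d a = n := fun a => hB a n
    let e : (B n : Finset α) ≃ {a // d a = n} := Equiv.subtypeEquivRight h1
    rw [← e.hasSum_iff]
    exact (B n).hasSum f
  have hs : Summable fun x : Σ n, {a // d a = n} => f x.2 := by
    rw [summable_sigma_of_nonneg fun x => hf _]
    refine ⟨fun n => (hfib n).summable, ?_⟩
    simp_rw [fun n => (hfib n).tsum_eq]
    exact h.summable
  have h2 : HasSum (fun x : Σ n, {a // d a = n} => f x.2) c := by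
    have h3 := hs.hasSum.sigma hfib
    rw [← h3.unique h]
    exact hs.hasSum
  exact ((Equiv.sigmaFiberEquiv d).hasSum_iff (f := f)).1 h2

/-- The monic polynomials over a field. -/
abbrev MonicPoly (F : Type) [Field F] : Type := {g : F[X] // g.Monic}

theorem hasSum_pow_natDegree {y : ℝ} (hy : 0 ≤ y) (hqy : Fintype.card F * y < 1) :
    HasSum (fun g : MonicPoly F => y ^ g.1.natDegree) (1 - Fintype.card F * y)⁻¹ := by
  classical
  refine hasSum_of_hasSum_fibers (fun g : MonicPoly F => g.1.natDegree)
    (fun n => (monics F n).subtype Monic) (fun g n => ?_) (fun g => by positivity) ?_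
  · rw [Finset.mem_subtype, mem_monics]
    exact and_iff_right g.2
  · convert hasSum_geometric_of_lt_one (r := Fintype.card F * y) (by positivity) hqy using 2
      with n
    have h1 : ∀ g ∈ (monics F n).subtype Monic, y ^ g.1.natDegree = y ^ n := by
      intro g hg
      rw [Finset.mem_subtype, mem_monics] at hg
      rw [hg.2]
    rw [Finset.sum_congr rfl h1, Finset.sum_const, Finset.card_subtype,
      Finset.filter_true_of_mem fun g hg => (mem_monics.1 hg).1, card_monics, nsmul_eq_mul,
      mul_pow]
    push_cast
    rfl

open Classical in
theorem hasSum_pow_natDegree_sieve {y : ℝ} (hy : 0 ≤ y) (hqy : Fintype.card F * y < 1)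
    (S : Finset (MonicIrr F)) :
    HasSum (fun g : MonicPoly F => if ∀ P ∈ S, ¬ P.1 ∣ g.1 then y ^ g.1.natDegree else 0)
      ((1 - Fintype.card F * y)⁻¹ * ∏ P ∈ S, (1 - y ^ P.1.natDegree)) := by
  induction S using Finset.induction_on with
  | empty => simpa using hasSum_pow_natDegree hy hqy
  | insert P S hP ih =>
    let m : MonicPoly F → MonicPoly F := fun g => ⟨P.1 * g.1, P.2.1.mul g.2⟩
    have hm : Function.Injective m := fun g h hgh =>
      Subtype.ext (mul_left_cancel₀ P.2.1.ne_zero (congrArg Subtype.val hgh))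
    have h1 : HasSum (fun g : MonicPoly F => if (∀ Q ∈ S, ¬ Q.1 ∣ g.1) ∧ P.1 ∣ g.1 then
        y ^ g.1.natDegree else 0) (y ^ P.1.natDegree *
          ((1 - Fintype.card F * y)⁻¹ * ∏ P ∈ S, (1 - y ^ P.1.natDegree))) := by
      rw [← hm.hasSum_iff]
      · refine (congrArg (HasSum · _) (funext fun g => ?_)).mp (ih.mul_left (y ^ P.1.natDegree))
        have h2 : (∀ Q ∈ S, ¬ Q.1 ∣ P.1 * g.1) ↔ ∀ Q ∈ S, ¬ Q.1 ∣ g.1 :=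
          forall₂_congr fun Q hQ =>
            (MonicIrr.dvd_mul_iff_of_ne (ne_of_mem_of_not_mem hQ hP) g.1).not
        simp only [Function.comp_apply, m, h2, dvd_mul_right, and_true,
          P.2.1.natDegree_mul g.2, pow_add, mul_ite, mul_zero]
      · intro g hg
        rw [if_neg]
        rintro ⟨-, b, hb⟩
        refine hg ⟨⟨b, P.2.1.of_mul_monic_left (hb ▸ g.2)⟩, Subtype.ext hb.symm⟩
    have h2 : (1 - Fintype.card F * y)⁻¹ * ∏ Q ∈ insert P S, (1 - y ^ Q.1.natDegree) =
        (1 - Fintype.card F * y)⁻¹ * ∏ Q ∈ S, (1 - y ^ Q.1.natDegree) - y ^ P.1.natDegree *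
          ((1 - Fintype.card F * y)⁻¹ * ∏ Q ∈ S, (1 - y ^ Q.1.natDegree)) := by
      rw [Finset.prod_insert hP]
      ring
    rw [h2]
    refine (congrArg (HasSum · _) (funext fun g => ?_)).mp (ih.sub h1)
    simp only [Finset.forall_mem_insert]
    by_cases h3 : P.1 ∣ g.1 <;> simp [h3]

theorem hasProd_one_sub_pow_natDegree {y : ℝ} (hy : 0 ≤ y) (hqy : Fintype.card F * y < 1) :
    HasProd (fun P : MonicIrr F => 1 - y ^ P.1.natDegree) (1 - Fintype.card F * y) := by
  classical
  have h1 : Tendsto (fun S : Finset (MonicIrr F) => ∑' g : MonicPoly F,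
      if ∀ P ∈ S, ¬ P.1 ∣ g.1 then y ^ g.1.natDegree else 0) atTop
      (𝓝 (∑' g : MonicPoly F, if g = ⟨1, monic_one⟩ then 1 else 0)) := by
    refine tendsto_tsum_of_dominated_convergence (hasSum_pow_natDegree hy hqy).summable ?_ ?_
    · intro g
      refine tendsto_const_nhds.congr' ?_
      by_cases hg : g = ⟨1, monic_one⟩
      · refine Eventually.of_forall fun S => ?_
        subst hg
        beta_reduce
        rw [if_pos rfl, if_pos fun P _ h => P.2.2.not_isUnit (isUnit_of_dvd_one h)]
        simp
      · have hu : ¬ IsUnit g.1 := fun h => hg (Subtype.ext (g.2.eq_one_of_isUnit h))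
        obtain ⟨z, hz, hzg⟩ := WfDvdMonoid.exists_irreducible_factor hu g.2.ne_zero
        obtain ⟨P, hP⟩ := exists_monicIrr_dvd hz
        filter_upwards [eventually_ge_atTop {P}] with S hS
        rw [if_neg hg, if_neg fun h => h P (hS (Finset.mem_singleton_self P)) (hP.trans hzg)]
    · refine Eventually.of_forall fun S g => ?_
      split_ifs
      · rw [Real.norm_of_nonneg (by positivity)]
      · simpa using by positivity
  have h0 : (1 - Fintype.card F * y) ≠ 0 := by linarith
  simp_rw [fun S => (hasSum_pow_natDegree_sieve hy hqy S).tsum_eq, tsum_ite_eq] at h1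
  have h2 := h1.const_mul (1 - Fintype.card F * y)
  simp_rw [mul_inv_cancel_left₀ h0, mul_one] at h2
  simpa [HasProd] using h2

theorem irrDivisors_prod (S : Finset (MonicIrr F)) : irrDivisors (∏ P ∈ S, P.1) = S := by
  ext P
  rw [mem_irrDivisors (monic_prod_monicIrr S), P.prime.dvd_finsetProd_iff]
  refine ⟨?_, fun h => ⟨P, h, dvd_rfl⟩⟩
  rintro ⟨Q, hQ, h⟩
  rwa [MonicIrr.eq_of_dvd h]

open Classical in
/-- The finite sets of monic irreducible polynomials of total degree `j`. -/
noncomputable def irrSets (F : Type) [Field F] [Fintype F] (j : ℕ) : Finset (Finset (MonicIrr F)) :=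
  ((monics F j).image irrDivisors).filter fun S => ∑ P ∈ S, P.1.natDegree = j

theorem mem_irrSets {S : Finset (MonicIrr F)} {j : ℕ} :
    S ∈ irrSets F j ↔ ∑ P ∈ S, P.1.natDegree = j := by
  classical
  rw [irrSets, Finset.mem_filter, and_iff_right_iff_imp]
  exact fun h => Finset.mem_image.2 ⟨_, mem_monics.2 ⟨monic_prod_monicIrr S,
    (natDegree_prod_monicIrr S).trans h⟩, irrDivisors_prod S⟩

/-- The weight `1 / (q ^ deg P - 1)`. -/
noncomputable def fullWeight (P : MonicIrr F) : ℝ :=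
  ((Fintype.card F : ℝ)⁻¹) ^ P.1.natDegree / (1 - ((Fintype.card F : ℝ)⁻¹) ^ P.1.natDegree)

open Classical in
/-- The weight `1 / (q ^ deg P - 1)`, set to zero at `X` and `X - 1`. -/
noncomputable def weight (P : MonicIrr F) : ℝ :=
  if P = MonicIrr.X F ∨ P = MonicIrr.XSubOne F then 0 else fullWeight P

theorem inv_card_pos : 0 < (Fintype.card F : ℝ)⁻¹ := by
  have : 0 < Fintype.card F := Fintype.card_pos
  positivity

theorem inv_card_le_half : (Fintype.card F : ℝ)⁻¹ ≤ 1 / 2 := by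
  have h : (2 : ℝ) ≤ Fintype.card F := by exact_mod_cast Fintype.one_lt_card (α := F)
  rw [one_div]
  exact inv_anti₀ two_pos h

theorem inv_card_pow_lt_one (P : MonicIrr F) : ((Fintype.card F : ℝ)⁻¹) ^ P.1.natDegree < 1 :=
  pow_lt_one₀ inv_card_pos.le (inv_card_le_half.trans_lt (by norm_num)) P.natDegree_pos.ne'

theorem fullWeight_nonneg (P : MonicIrr F) : 0 ≤ fullWeight P :=
  div_nonneg (pow_nonneg inv_card_pos.le _) (sub_nonneg.2 (inv_card_pow_lt_one P).le)

theorem weight_nonneg (P : MonicIrr F) : 0 ≤ weight P := by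
  rw [weight]
  split_ifs
  exacts [le_rfl, fullWeight_nonneg P]

theorem weight_le_fullWeight (P : MonicIrr F) : weight P ≤ fullWeight P := by
  rw [weight]
  split_ifs
  exacts [fullWeight_nonneg P, le_rfl]

theorem prod_fullWeight (S : Finset (MonicIrr F)) :
    ∏ P ∈ S, fullWeight P = 1 / Nat.card (AdjoinRoot (∏ P ∈ S, P.1))ˣ := by
  rw [nat_card_units_adjoinRoot (monic_prod_monicIrr S), irrDivisors_prod, natDegree_prod_monicIrr]
  simp_rw [fullWeight]
  rw [Finset.prod_div_distrib, Finset.prod_pow_eq_pow_sum, inv_pow, one_div, mul_inv,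
    div_eq_mul_inv]

/-- The sum over the finite sets of total degree `j` of the product of the weights. -/
noncomputable def weightSum (F : Type) [Field F] [Fintype F] (j : ℕ) : ℝ :=
  ∑ S ∈ irrSets F j, ∏ P ∈ S, weight P

theorem weightSum_nonneg (j : ℕ) : 0 ≤ weightSum F j :=
  Finset.sum_nonneg fun _ _ => Finset.prod_nonneg fun P _ => weight_nonneg P

theorem prod_weight_eq_zero {S : Finset (MonicIrr F)} (h : MonicIrr.X F ∈ S) :
    ∏ P ∈ S, weight P = 0 :=
  Finset.prod_eq_zero h (by simp [weight])

theorem X_dvd_prod_iff {S : Finset (MonicIrr F)} :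
    (X : F[X]) ∣ ∏ P ∈ S, P.1 ↔ MonicIrr.X F ∈ S := by
  have h := mem_irrDivisors (monic_prod_monicIrr S) (P := MonicIrr.X F)
  rw [irrDivisors_prod] at h
  exact h.symm

theorem weightSum_le_one (j : ℕ) : weightSum F j ≤ 1 := by
  classical
  have hinj : Set.InjOn (fun S : Finset (MonicIrr F) => ∏ P ∈ S, P.1)
      ((irrSets F j).filter fun S => MonicIrr.X F ∉ S : Finset _) := fun S _ S' _ h => by
    rw [← irrDivisors_prod S, ← irrDivisors_prod S']
    exact congrArg irrDivisors h
  calc weightSum F j = ∑ S ∈ irrSets F j with MonicIrr.X F ∉ S, ∏ P ∈ S, weight P := by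
        rw [weightSum]
        refine (Finset.sum_subset (Finset.filter_subset _ _) fun S hS hS' => ?_).symm
        refine prod_weight_eq_zero (by_contra fun h => hS' (Finset.mem_filter.2 ⟨hS, h⟩))
    _ ≤ ∑ S ∈ irrSets F j with MonicIrr.X F ∉ S,
          (1 : ℝ) / Nat.card (AdjoinRoot (∏ P ∈ S, P.1))ˣ := by
        refine Finset.sum_le_sum fun S _ => ?_
        rw [← prod_fullWeight]
        exact Finset.prod_le_prod (fun P _ => weight_nonneg P) fun P _ => weight_le_fullWeight P
    _ = ∑ k ∈ ((irrSets F j).filter fun S => MonicIrr.X F ∉ S).image fun S => ∏ P ∈ S, P.1,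
          (1 : ℝ) / Nat.card (AdjoinRoot k)ˣ :=
        (Finset.sum_image (f := fun k => (1 : ℝ) / Nat.card (AdjoinRoot k)ˣ) hinj).symm
    _ ≤ ∑ k ∈ monics F j with ¬ X ∣ k, (1 : ℝ) / Nat.card (AdjoinRoot k)ˣ := by
        refine Finset.sum_le_sum_of_subset_of_nonneg (fun k hk => ?_) fun k _ _ => by positivity
        obtain ⟨S, hS, rfl⟩ := Finset.mem_image.1 hk
        rw [Finset.mem_filter, mem_irrSets] at hS
        rw [Finset.mem_filter, mem_monics, natDegree_prod_monicIrr, X_dvd_prod_iff]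
        exact ⟨⟨monic_prod_monicIrr S, hS.1⟩, hS.2⟩
    _ ≤ 1 := sum_one_div_nat_card_units_le_one j

open Classical in
theorem filter_dvd_monics {d : F[X]} (hd : d.Monic) {n : ℕ} (hn : d.natDegree ≤ n) :
    (monics F n).filter (d ∣ ·) = (monics F (n - d.natDegree)).image (d * ·) := by
  ext k
  rw [Finset.mem_filter, Finset.mem_image, mem_monics]
  constructor
  · rintro ⟨⟨hk, hkn⟩, b, rfl⟩
    have hb := hd.of_mul_monic_left hk
    rw [hd.natDegree_mul hb] at hkn
    exact ⟨b, mem_monics.2 ⟨hb, by omega⟩, rfl⟩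
  · rintro ⟨b, hb, rfl⟩
    rw [mem_monics] at hb
    rw [hd.natDegree_mul hb.1]
    exact ⟨⟨hd.mul hb.1, by omega⟩, dvd_mul_right _ _⟩

open Classical in
/-- The number of monic polynomials of degree `m` not divisible by `X`. -/
noncomputable def cardMonicsNotDvd (F : Type) [Field F] [Fintype F] (m : ℕ) : ℕ :=
  ((monics F m).filter fun k => ¬ X ∣ k).card

theorem cardMonicsNotDvd_zero : cardMonicsNotDvd F 0 = 1 := by
  classical
  rw [cardMonicsNotDvd, Finset.filter_true_of_mem, card_monics, pow_zero]
  intro k hk h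
  rw [mem_monics] at hk
  exact not_isUnit_X (isUnit_of_dvd_one (hk.1.natDegree_eq_zero.1 hk.2 ▸ h))

theorem cardMonicsNotDvd_succ (m : ℕ) : (cardMonicsNotDvd F (m + 1) : ℝ) =
    (Fintype.card F : ℝ) ^ (m + 1) - (Fintype.card F : ℝ) ^ m := by
  classical
  have h := Finset.card_filter_add_card_filter_not (s := monics F (m + 1)) (fun k => X ∣ k)
  have hinj : Function.Injective fun k : F[X] => X * k := mul_right_injective₀ X_ne_zero
  rw [filter_dvd_monics monic_X (by simp), Finset.card_image_of_injective _ hinj, natDegree_X,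
    card_monics, card_monics, Nat.add_sub_cancel] at h
  rw [cardMonicsNotDvd, eq_sub_iff_add_eq']
  exact_mod_cast h

open Classical in
theorem card_filter_subset_irrDivisors {S : Finset (MonicIrr F)} (hS : MonicIrr.X F ∉ S) {j n : ℕ}
    (hj : ∑ P ∈ S, P.1.natDegree = j) (hn : j ≤ n) :
    (((monics F n).filter fun k => ¬ X ∣ k).filter fun k => S ⊆ irrDivisors k).card =
      cardMonicsNotDvd F (n - j) := by
  have hd := monic_prod_monicIrr S
  have hdeg : (∏ P ∈ S, P.1).natDegree = j := (natDegree_prod_monicIrr S).trans hj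
  have hinj : Function.Injective fun k : F[X] => (∏ P ∈ S, P.1) * k :=
    mul_right_injective₀ hd.ne_zero
  have h1 : ((monics F n).filter fun k => ¬ X ∣ k).filter (fun k => S ⊆ irrDivisors k) =
      ((monics F n).filter (∏ P ∈ S, P.1 ∣ ·)).filter fun k => ¬ X ∣ k := by
    rw [Finset.filter_comm]
    congr 1
    refine Finset.filter_congr fun k hk => ?_
    rw [prod_monicIrr_dvd_iff]
    exact forall₂_congr fun P _ => mem_irrDivisors (mem_monics.1 hk).1
  rw [h1, filter_dvd_monics hd (hdeg.trans_le hn), Finset.filter_image,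
    Finset.card_image_of_injective _ hinj, cardMonicsNotDvd, hdeg]
  congr 1
  refine Finset.filter_congr fun k _ => not_congr ?_
  rw [Polynomial.prime_X.dvd_mul, X_dvd_prod_iff]
  exact or_iff_right hS

theorem one_div_nat_card_units {k : F[X]} (hk : k.Monic) (hX : ¬ X ∣ k) :
    ((Fintype.card F : ℝ) - 1) / Nat.card (AdjoinRoot ((X - 1) * k))ˣ =
      ((Fintype.card F : ℝ)⁻¹) ^ k.natDegree * ∏ P ∈ irrDivisors k, (1 + weight P) := by
  classical
  have h1 : (X - 1 : F[X]).Monic := (MonicIrr.XSubOne F).2.1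
  have hirr : irrDivisors ((X - 1) * k) =
      insert (MonicIrr.XSubOne F) ((irrDivisors k).erase (MonicIrr.XSubOne F)) := by
    ext P
    rw [mem_irrDivisors (h1.mul hk), Finset.mem_insert, Finset.mem_erase, mem_irrDivisors hk]
    by_cases hP : P = MonicIrr.XSubOne F
    · simp [hP, MonicIrr.XSubOne]
    · have := MonicIrr.dvd_mul_iff_of_ne hP k
      rw [MonicIrr.XSubOne] at this
      simp [hP, this]
  have h2 : ∏ P ∈ irrDivisors k, (1 + weight P) =
      ∏ P ∈ (irrDivisors k).erase (MonicIrr.XSubOne F), (1 + weight P) :=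
    (Finset.prod_erase _ (by simp [weight])).symm
  have h3 : (∏ P ∈ (irrDivisors k).erase (MonicIrr.XSubOne F), (1 + weight P)) *
      ∏ P ∈ (irrDivisors k).erase (MonicIrr.XSubOne F),
        (1 - ((Fintype.card F : ℝ)⁻¹) ^ P.1.natDegree) = 1 := by
    rw [← Finset.prod_mul_distrib]
    refine Finset.prod_eq_one fun P hP => ?_
    rw [Finset.mem_erase, mem_irrDivisors hk] at hP
    have hPX : P ≠ MonicIrr.X F := fun h => hX (h ▸ hP.2 :)
    have := (sub_pos.2 (inv_card_pow_lt_one P)).ne'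
    rw [weight, if_neg (not_or.2 ⟨hPX, hP.1⟩), fullWeight]
    rw [add_mul, div_mul_cancel₀ _ this]
    ring
  have hdeg : ((X - 1) * k).natDegree = k.natDegree + 1 := by
    rw [h1.natDegree_mul hk, add_comm]
    exact congrArg _ MonicIrr.natDegree_XSubOne
  have hq : (Fintype.card F : ℝ) ≠ 0 := by simp
  have hq1 : (Fintype.card F : ℝ) - 1 ≠ 0 :=
    (sub_pos.2 (by exact_mod_cast Fintype.one_lt_card)).ne'
  rw [nat_card_units_adjoinRoot (h1.mul hk), hirr, Finset.prod_insert (Finset.notMem_erase _ _),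
    hdeg, h2, eq_inv_of_mul_eq_one_right h3, MonicIrr.natDegree_XSubOne, pow_one, inv_pow]
  have h4 := right_ne_zero_of_mul_eq_one h3
  field_simp
  ring

theorem cA_eq_sum_weightSum (n : ℕ) : cA F n = ((Fintype.card F : ℝ)⁻¹) ^ n *
    ∑ j ∈ Finset.range (n + 1), weightSum F j * cardMonicsNotDvd F (n - j) := by
  classical
  have hdis : Set.PairwiseDisjoint (Finset.range (n + 1) : Set ℕ) (irrSets F) := by
    intro i _ j _ hij
    refine Finset.disjoint_left.2 fun S hi hj => hij ?_
    rw [← mem_irrSets.1 hi, mem_irrSets.1 hj]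
  have h1 : ∀ k ∈ (monics F n).filter fun k => ¬ X ∣ k,
      ((Fintype.card F : ℝ) - 1) / Nat.card (AdjoinRoot ((X - 1) * k))ˣ =
      ((Fintype.card F : ℝ)⁻¹) ^ n * ∑ S ∈ (irrDivisors k).powerset, ∏ P ∈ S, weight P := by
    intro k hk
    rw [Finset.mem_filter, mem_monics] at hk
    rw [one_div_nat_card_units hk.1.1 hk.2, hk.1.2, Finset.prod_one_add]
  rw [cA_eq_sum, Finset.sum_congr rfl h1, ← Finset.mul_sum, Finset.sum_comm'
    (t' := (Finset.range (n + 1)).biUnion (irrSets F))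
    (s' := fun S => ((monics F n).filter fun k => ¬ X ∣ k).filter fun k => S ⊆ irrDivisors k),
    Finset.sum_biUnion hdis]
  · congr 1
    refine Finset.sum_congr rfl fun j hj => ?_
    rw [weightSum, Finset.sum_mul]
    refine Finset.sum_congr rfl fun S hS => ?_
    rw [Finset.sum_const, nsmul_eq_mul, mul_comm]
    by_cases hX : MonicIrr.X F ∈ S
    · rw [prod_weight_eq_zero hX, zero_mul, zero_mul]
    · rw [card_filter_subset_irrDivisors hX (mem_irrSets.1 hS)
        (Nat.lt_succ_iff.1 (Finset.mem_range.1 hj))]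
  · intro k S
    rw [Finset.mem_powerset, Finset.mem_filter (p := fun k => S ⊆ irrDivisors k),
      Finset.mem_biUnion]
    refine ⟨fun h => ⟨h, ?_⟩, fun h => h.1⟩
    have hk := mem_monics.1 (Finset.mem_filter.1 h.1).1
    refine ⟨_, Finset.mem_range.2 (Nat.lt_succ_of_le ?_), mem_irrSets.2 rfl⟩
    rw [← natDegree_prod_monicIrr, ← hk.2]
    exact natDegree_le_of_dvd
      ((prod_monicIrr_dvd_iff S).2 fun P hP => (mem_irrDivisors hk.1).1 (h.2 hP)) hk.1.ne_zero

theorem cA_eq (n : ℕ) : cA F n = ((Fintype.card F : ℝ)⁻¹) ^ n * weightSum F n +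
    (1 - (Fintype.card F : ℝ)⁻¹) *
      ∑ j ∈ Finset.range n, weightSum F j * ((Fintype.card F : ℝ)⁻¹) ^ j := by
  have hq : (Fintype.card F : ℝ) ≠ 0 := by simp
  rw [cA_eq_sum_weightSum, Finset.sum_range_succ, Nat.sub_self, cardMonicsNotDvd_zero, mul_add,
    add_comm, Nat.cast_one, mul_one, Finset.mul_sum, Finset.mul_sum]
  congr 1
  refine Finset.sum_congr rfl fun j hj => ?_
  obtain ⟨m, rfl⟩ := Nat.exists_eq_add_of_lt (Finset.mem_range.1 hj)
  rw [show j + m + 1 - j = m + 1 by omega, cardMonicsNotDvd_succ, inv_pow, inv_pow]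
  field_simp
  ring

theorem summable_weightSum : Summable fun j => weightSum F j * ((Fintype.card F : ℝ)⁻¹) ^ j := by
  have hlt : (Fintype.card F : ℝ)⁻¹ < 1 := inv_card_le_half.trans_lt (by norm_num)
  refine Summable.of_nonneg_of_le
    (fun j => mul_nonneg (weightSum_nonneg j) (pow_nonneg inv_card_pos.le j)) (fun j => ?_)
    (summable_geometric_of_lt_one inv_card_pos.le hlt)
  exact mul_le_of_le_one_left (pow_nonneg inv_card_pos.le j) (weightSum_le_one j)

theorem hasProd_weight :
    HasProd (fun P : MonicIrr F => 1 + weight P * ((Fintype.card F : ℝ)⁻¹) ^ P.1.natDegree)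
      (∑' j, weightSum F j * ((Fintype.card F : ℝ)⁻¹) ^ j) := by
  refine hasProd_one_add_of_hasSum_prod (hasSum_of_hasSum_fibers
    (fun S => ∑ P ∈ S, P.1.natDegree) (irrSets F) (fun S j => mem_irrSets) (fun S => ?_) ?_)
  · exact Finset.prod_nonneg fun P _ => mul_nonneg (weight_nonneg P) (pow_nonneg inv_card_pos.le _)
  · convert summable_weightSum.hasSum using 2 with j
    rw [weightSum, Finset.sum_mul]
    refine Finset.sum_congr rfl fun S hS => ?_
    rw [Finset.prod_mul_distrib, Finset.prod_pow_eq_pow_sum, mem_irrSets.1 hS]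

theorem tsum_weightSum_mul :
    (∑' j, weightSum F j * ((Fintype.card F : ℝ)⁻¹) ^ j) *
      (1 + (Fintype.card F : ℝ)⁻¹ ^ 2 / (1 - (Fintype.card F : ℝ)⁻¹)) ^ 2 *
        ((1 - (Fintype.card F : ℝ)⁻¹) * (1 - (Fintype.card F : ℝ)⁻¹ ^ 2)) =
      1 - (Fintype.card F : ℝ)⁻¹ ^ 5 := by
  classical
  have hq : (Fintype.card F : ℝ) ≠ 0 := by simp
  have hlt : (Fintype.card F : ℝ)⁻¹ < 1 := inv_card_le_half.trans_lt (by norm_num)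
  have hmul : ∀ m, Fintype.card F * (Fintype.card F : ℝ)⁻¹ ^ (m + 1) =
      (Fintype.card F : ℝ)⁻¹ ^ m := fun m => by
    rw [pow_succ', mul_inv_cancel_left₀ hq]
  have heuler : ∀ m ≠ 0, HasProd
      (fun P : MonicIrr F => 1 - ((Fintype.card F : ℝ)⁻¹ ^ (m + 1)) ^ P.1.natDegree)
      (1 - (Fintype.card F : ℝ)⁻¹ ^ m) := fun m hm => by
    rw [← hmul m]
    refine hasProd_one_sub_pow_natDegree (pow_nonneg inv_card_pos.le _) ?_
    rw [hmul]
    exact pow_lt_one₀ inv_card_pos.le hlt hm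
  have hcorr : HasProd (fun P : MonicIrr F =>
      if P = MonicIrr.X F ∨ P = MonicIrr.XSubOne F then
        1 + (Fintype.card F : ℝ)⁻¹ ^ 2 / (1 - (Fintype.card F : ℝ)⁻¹) else 1)
      ((1 + (Fintype.card F : ℝ)⁻¹ ^ 2 / (1 - (Fintype.card F : ℝ)⁻¹)) ^ 2) := by
    have h := hasProd_prod_of_ne_finset_one (f := fun P : MonicIrr F =>
      if P = MonicIrr.X F ∨ P = MonicIrr.XSubOne F then
        1 + (Fintype.card F : ℝ)⁻¹ ^ 2 / (1 - (Fintype.card F : ℝ)⁻¹) else 1)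
      (s := {MonicIrr.X F, MonicIrr.XSubOne F}) (L := .unconditional _) fun P hP => by
        rw [Finset.mem_insert, Finset.mem_singleton] at hP
        exact if_neg hP
    rwa [Finset.prod_pair MonicIrr.X_ne_XSubOne, if_pos (Or.inl rfl), if_pos (Or.inr rfl),
      ← sq] at h
  have key : ∀ P : MonicIrr F,
      ((1 + weight P * (Fintype.card F : ℝ)⁻¹ ^ P.1.natDegree) *
        if P = MonicIrr.X F ∨ P = MonicIrr.XSubOne F then
          1 + (Fintype.card F : ℝ)⁻¹ ^ 2 / (1 - (Fintype.card F : ℝ)⁻¹) else 1) *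
        ((1 - ((Fintype.card F : ℝ)⁻¹ ^ (1 + 1)) ^ P.1.natDegree) *
          (1 - ((Fintype.card F : ℝ)⁻¹ ^ (2 + 1)) ^ P.1.natDegree)) =
      1 - ((Fintype.card F : ℝ)⁻¹ ^ (5 + 1)) ^ P.1.natDegree := by
    intro P
    have hP := (sub_pos.2 (inv_card_pow_lt_one P)).ne'
    simp_rw [← pow_mul, mul_comm _ P.1.natDegree, pow_mul]
    rw [weight, fullWeight]
    split_ifs with hc
    · have h1 : P.1.natDegree = 1 := by
        rcases hc with rfl | rfl
        exacts [MonicIrr.natDegree_X, MonicIrr.natDegree_XSubOne]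
      rw [h1, pow_one] at hP ⊢
      generalize (Fintype.card F : ℝ)⁻¹ = x at hP ⊢
      field_simp
      ring
    · generalize (Fintype.card F : ℝ)⁻¹ ^ P.1.natDegree = x at hP ⊢
      field_simp
      ring
  have h := ((hasProd_weight.mul hcorr).mul ((heuler 1 one_ne_zero).mul (heuler 2 two_ne_zero)))
  simp_rw [key, pow_one] at h
  exact h.unique (heuler 5 (by norm_num))

theorem one_sub_mul_tsum_weightSum :
    (1 - (Fintype.card F : ℝ)⁻¹) * ∑' j, weightSum F j * ((Fintype.card F : ℝ)⁻¹) ^ j =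
      ((1 - (Fintype.card F : ℝ)⁻¹) / (1 - (Fintype.card F : ℝ)⁻¹ + (Fintype.card F : ℝ)⁻¹ ^ 2)) *
        ((1 - (Fintype.card F : ℝ)⁻¹ ^ 5) / (1 + (Fintype.card F : ℝ)⁻¹ ^ 3)) := by
  have h := tsum_weightSum_mul (F := F)
  have h0 := inv_card_pos (F := F)
  have hlt : (Fintype.card F : ℝ)⁻¹ < 1 := inv_card_le_half.trans_lt (by norm_num)
  rw [← h]
  generalize (Fintype.card F : ℝ)⁻¹ = x at *
  have h1 : 1 - x ≠ 0 := (sub_pos.2 hlt).ne'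
  have h2 : 1 - x + x ^ 2 ≠ 0 := by positivity
  have h3 : 1 + x ^ 3 ≠ 0 := by positivity
  field_simp
  ring

theorem abs_tsum_weightSum_sub_cA_le (n : ℕ) :
    |(1 - (Fintype.card F : ℝ)⁻¹) * (∑' j, weightSum F j * ((Fintype.card F : ℝ)⁻¹) ^ j) - cA F n| ≤
      ((Fintype.card F : ℝ)⁻¹) ^ (n + 1) := by
  have h0 := inv_card_pos (F := F)
  have hlt : (Fintype.card F : ℝ)⁻¹ < 1 := inv_card_le_half.trans_lt (by norm_num)
  have hs := summable_weightSum (F := F)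
  rw [cA_eq, ← hs.sum_add_tsum_nat_add (n + 1), Finset.sum_range_succ]
  have htail0 : 0 ≤ ∑' j, weightSum F (j + (n + 1)) * ((Fintype.card F : ℝ)⁻¹) ^ (j + (n + 1)) :=
    tsum_nonneg fun j => mul_nonneg (weightSum_nonneg _) (pow_nonneg h0.le _)
  have htail1 : (1 - (Fintype.card F : ℝ)⁻¹) *
      ∑' j, weightSum F (j + (n + 1)) * ((Fintype.card F : ℝ)⁻¹) ^ (j + (n + 1)) ≤
      ((Fintype.card F : ℝ)⁻¹) ^ (n + 1) := by
    have hg := (hasSum_geometric_of_lt_one h0.le hlt).mul_right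
      (((Fintype.card F : ℝ)⁻¹) ^ (n + 1))
    rw [← le_inv_mul_iff₀ (sub_pos.2 hlt)]
    refine hasSum_le (fun j => ?_) ((summable_nat_add_iff (n + 1)).2 hs).hasSum hg
    rw [← pow_add]
    exact mul_le_of_le_one_left (pow_nonneg h0.le _) (weightSum_le_one _)
  have hn0 := mul_nonneg (weightSum_nonneg (F := F) n) (pow_nonneg h0.le (n + 1))
  have hn1 := mul_le_of_le_one_left (pow_nonneg h0.le (n + 1)) (weightSum_le_one (F := F) n)
  have h1 := mul_nonneg (sub_nonneg.2 hlt.le) htail0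
  rw [pow_succ] at hn0 hn1 htail1 ⊢
  rw [abs_le]
  constructor <;> linarith

end Sieve

/-- The convergence of `c_A(n,q)` to its limit
`c_A(∞,q) = [(1 - 1/q)/(1 - 1/q + 1/q²)][(1 - 1/q⁵)/(1 + 1/q³)]` satisfies
`|c_A(∞,q) - c_A(n,q)| ≤ 1/(q^{n+1}(1 - 1/q))` for every `n ≥ 0`. -/
theorem affine_cyclic_convergence_rate (F : Type) [Field F] [Fintype F] (q : ℕ)
    (hq : q = Fintype.card F) (n : ℕ) :
    |((1 - 1 / (q : ℝ)) / (1 - 1 / (q : ℝ) + 1 / (q : ℝ) ^ 2)) *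
        ((1 - 1 / (q : ℝ) ^ 5) / (1 + 1 / (q : ℝ) ^ 3)) - cA F n| ≤
      1 / ((q : ℝ) ^ (n + 1) * (1 - 1 / (q : ℝ))) := by
  subst hq
  have hlt : (Fintype.card F : ℝ)⁻¹ < 1 := inv_card_le_half.trans_lt (by norm_num)
  have h := abs_tsum_weightSum_sub_cA_le (F := F) n
  rw [one_sub_mul_tsum_weightSum] at h
  simp only [one_div, mul_inv, ← inv_pow]
  exact h.trans (le_mul_of_one_le_right (pow_nonneg inv_card_pos.le _)
    ((one_le_inv₀ (sub_pos.2 hlt)).2 (sub_le_self _ inv_card_pos.le)))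
end

section
/- Let q be a prime power. For every n ≥ 0, Σ_{k=0}^{n} ss_A(n−k, q) / (q^{k^2} (1/q)_k) = Σ_{k=0}^{n} ss_GL(n−k, q) / (q^{k^2+k} (1/q)_k), where (1/q)_k = ∏_{j=1}^k (1 − 1/q^j); equivalently, the generating function identity (Σ_n ss_A(n,q)u^n)·(Σ_{k≥0} u^k/(q^{k^2}(1/q)_k)) = (Σ_n ss_GL(n,q)u^n)·(Σ_{k≥0} u^k/(q^{k^2+k}(1/q)_k)) holds coefficientwise. -/
open Matrix

/-- `ss_A(n,q)`: the proportion of semisimple elements (squarefree minimal polynomial;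
over a perfect field this is equivalent to diagonalizability over the algebraic closure)
of the affine group `A(n,q)`. -/
noncomputable def ssA (F : Type) [Field F] [Fintype F] (n : ℕ) : ℝ :=
  (Nat.card {x : GL (Fin (n + 1)) F // IsAff x ∧ Squarefree (minpoly F x.val)} : ℝ) /
    (Nat.card {x : GL (Fin (n + 1)) F // IsAff x} : ℝ)

/-- `ss_GL(n,q)`: the proportion of semisimple elements of `GL(n, F_q)`. -/
noncomputable def ssGL (F : Type) [Field F] [Fintype F] (n : ℕ) : ℝ :=
  (Nat.card {x : GL (Fin n) F // Squarefree (minpoly F x.val)} : ℝ) /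
    (Nat.card (GL (Fin n) F) : ℝ)

/-- `(1/q)_k = ∏_{j=1}^k (1 - 1/q^j)`. -/
noncomputable def qpoch (q : ℝ) (k : ℕ) : ℝ := ∏ j ∈ Finset.Icc 1 k, (1 - 1 / q ^ j)

open Polynomial

lemma rank_fromBlocks_zero_zero_zero {F α β : Type*} [Field F] [Fintype α] [Fintype β]
    [DecidableEq β] (N : Matrix β β F) :
    (fromBlocks (0 : Matrix α α F) 0 0 N).rank = N.rank := by
  apply le_antisymm
  · have : fromBlocks (0 : Matrix α α F) 0 0 N =
        fromRows (0 : Matrix α β F) 1 * (N * fromCols (0 : Matrix β α F) 1) := by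
      ext (i | i) (j | j) <;> simp [mul_fromCols, fromRows_mul]
    rw [this]
    exact (rank_mul_le_right _ _).trans (rank_mul_le_left _ _)
  · have : N = (fromCols 0 1 : Matrix β (α ⊕ β) F) *
        (fromBlocks (0 : Matrix α α F) 0 0 N * (fromRows 0 1 : Matrix (α ⊕ β) β F)) := by
      simp [fromBlocks_mul_fromRows, fromCols_mul_fromRows]
    calc N.rank = _ := congrArg Matrix.rank this
      _ ≤ _ := (rank_mul_le_right _ _).trans (rank_mul_le_left _ _)

lemma card_row_space {F β : Type*} [Field F] [Fintype F] [Fintype β] (N : Matrix β β F) :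
    Nat.card {b : Matrix Unit β F // ∃ c : Matrix Unit β F, c * N = b} =
      Fintype.card F ^ N.rank := by
  rw [← rank_transpose, ← Nat.card_eq_fintype_card, Matrix.rank, ← Module.natCard_eq_pow_finrank]
  refine Nat.card_congr ((Equiv.funUnique Unit (β → F)).subtypeEquiv fun b => ?_)
  constructor
  · rintro ⟨c, rfl⟩
    exact ⟨c (), by ext; simp [Matrix.mul_apply, vecMul, dotProduct]⟩
  · rintro ⟨c, hc⟩
    refine ⟨of fun _ => c, ?_⟩
    ext i j
    have := congrFun hc j
    simpa [mulVec_transpose, Matrix.mul_apply, vecMul, dotProduct] using this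

section Squarefree

variable {F : Type*} [Field F] {ι κ α β : Type*} [Fintype ι] [DecidableEq ι] [Fintype κ]
  [DecidableEq κ] [Fintype α] [DecidableEq α] [Fintype β] [DecidableEq β]

lemma squarefree_minpoly_iff (A : Matrix ι ι F) :
    Squarefree (minpoly F A) ↔ ∃ p : F[X], Squarefree p ∧ aeval A p = 0 :=
  ⟨fun h => ⟨_, h, minpoly.aeval F A⟩, fun ⟨_, hp, h⟩ => hp.squarefree_of_dvd (minpoly.dvd F A h)⟩

lemma aeval_mul_of_intertwine {A : Matrix ι ι F} {B : Matrix κ κ F} {P : Matrix ι κ F}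
    (h : A * P = P * B) (p : F[X]) : aeval A p * P = P * aeval B p := by
  induction p using Polynomial.induction_on' with
  | add p q hp hq => simp [Matrix.add_mul, Matrix.mul_add, hp, hq]
  | monomial n a =>
    have hn : A ^ n * P = P * B ^ n := by
      induction n with
      | zero => simp
      | succ n ih => rw [pow_succ, Matrix.mul_assoc, h, ← Matrix.mul_assoc, ih, pow_succ,
          Matrix.mul_assoc]
    simp [aeval_monomial, ← Algebra.smul_def, hn]

lemma squarefree_minpoly_of_left_inverse {A : Matrix ι ι F} {B : Matrix κ κ F} {P : Matrix ι κ F}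
    {Q : Matrix κ ι F} (h : A * P = P * B) (hQ : Q * P = 1) (hA : Squarefree (minpoly F A)) :
    Squarefree (minpoly F B) := by
  refine (squarefree_minpoly_iff B).2 ⟨_, hA, ?_⟩
  have := aeval_mul_of_intertwine h (minpoly F A)
  rw [minpoly.aeval, Matrix.zero_mul] at this
  rw [← Matrix.one_mul (aeval B _), ← hQ, Matrix.mul_assoc, ← this, Matrix.mul_zero]

lemma squarefree_minpoly_of_right_inverse {A : Matrix ι ι F} {B : Matrix κ κ F} {P : Matrix ι κ F}
    {Q : Matrix κ ι F} (h : A * P = P * B) (hQ : P * Q = 1) (hB : Squarefree (minpoly F B)) :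
    Squarefree (minpoly F A) := by
  refine (squarefree_minpoly_iff A).2 ⟨_, hB, ?_⟩
  have := aeval_mul_of_intertwine h (minpoly F B)
  rw [minpoly.aeval, Matrix.mul_zero] at this
  rw [← Matrix.mul_one (aeval A _), ← hQ, ← Matrix.mul_assoc, this, Matrix.zero_mul]

lemma squarefree_minpoly_conj_iff {A B : Matrix ι ι F} {g : GL ι F}
    (h : A * g.val = g.val * B) : Squarefree (minpoly F A) ↔ Squarefree (minpoly F B) :=
  ⟨squarefree_minpoly_of_left_inverse (Q := (g⁻¹).val) h (Units.inv_mul g),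
    squarefree_minpoly_of_right_inverse (Q := (g⁻¹).val) h (Units.mul_inv g)⟩

lemma aeval_fromBlocks_diagonal (A : Matrix α α F) (B : Matrix β β F) (p : F[X]) :
    aeval (fromBlocks A 0 0 B) p = fromBlocks (aeval A p) 0 0 (aeval B p) := by
  induction p using Polynomial.induction_on' with
  | add p q hp hq => simp [hp, hq, fromBlocks_add]
  | monomial n a =>
    simp [aeval_monomial, ← Algebra.smul_def, fromBlocks_diagonal_pow, fromBlocks_smul]

open UniqueFactorizationMonoid in
lemma squarefree_minpoly_fromBlocks_iff (A : Matrix α α F) (B : Matrix β β F) :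
    Squarefree (minpoly F (fromBlocks A 0 0 B)) ↔
      Squarefree (minpoly F A) ∧ Squarefree (minpoly F B) := by
  classical
  simp only [squarefree_minpoly_iff, aeval_fromBlocks_diagonal]
  constructor
  · rintro ⟨p, hp, h⟩
    rw [← fromBlocks_zero, fromBlocks_inj] at h
    exact ⟨⟨p, hp, h.1⟩, ⟨p, hp, h.2.2.2⟩⟩
  · rintro ⟨⟨p, hp, h⟩, ⟨r, hr, h'⟩⟩
    have h0 : p * r ≠ 0 := mul_ne_zero hp.ne_zero hr.ne_zero
    have h1 : p ∣ radical (p * r) := (dvd_radical_iff hp.isRadical h0).2 (dvd_mul_right _ _)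
    have h2 : r ∣ radical (p * r) := (dvd_radical_iff hr.isRadical h0).2 (dvd_mul_left _ _)
    refine ⟨_, squarefree_radical (a := p * r), ?_⟩
    rw [aeval_eq_zero_of_dvd_aeval_eq_zero h1 h, aeval_eq_zero_of_dvd_aeval_eq_zero h2 h',
      fromBlocks_zero]

lemma exists_eq_mul_sq_of_squarefree {A : Matrix ι ι F} (h : Squarefree (minpoly F A)) :
    ∃ p : F[X], A - 1 = aeval A p * (A - 1) ^ 2 := by
  suffices ∃ a b : F[X], a * (X - C 1) ^ 2 + b * minpoly F A = X - C 1 by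
    obtain ⟨a, b, hab⟩ := this
    refine ⟨a, ?_⟩
    simpa using (congrArg (aeval A) hab).symm
  have hirr := irreducible_X_sub_C (1 : F)
  by_cases hd : X - C 1 ∣ minpoly F A
  · obtain ⟨r, hr⟩ := hd
    rw [hr] at h ⊢
    obtain ⟨a, b, hab⟩ := (squarefree_mul_iff.1 h).1.isCoprime
    exact ⟨a, b, by linear_combination (X - C 1) * hab⟩
  · obtain ⟨a, b, hab⟩ := (hirr.coprime_iff_not_dvd.2 hd)
    exact ⟨a, (X - C 1) * b, by linear_combination (X - C 1) * hab⟩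

lemma squarefree_minpoly_one : Squarefree (minpoly F (1 : Matrix ι ι F)) :=
  (squarefree_minpoly_iff _).2 ⟨X - C 1, (irreducible_X_sub_C _).squarefree, by simp⟩

lemma rank_eq_card_iff_isUnit (N : Matrix β β F) : N.rank = Fintype.card β ↔ IsUnit N := by
  refine ⟨fun h => ?_, fun h => rank_of_isUnit N h⟩
  rw [← mulVec_surjective_iff_isUnit]
  have : LinearMap.range N.mulVecLin = ⊤ :=
    Submodule.eq_top_of_finrank_eq (by rw [Module.finrank_fintype_fun_eq_card]; exact h)
  exact LinearMap.range_eq_top.1 this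

end Squarefree

section Conjugation

variable {F : Type*} [Field F] {α β : Type*} [Fintype α] [DecidableEq α] [Fintype β]
  [DecidableEq β]

lemma isCompl_ker_range_of_squarefree {ι : Type*} [Fintype ι] [DecidableEq ι]
    {A : Matrix ι ι F} (h : Squarefree (minpoly F A)) :
    IsCompl (LinearMap.ker (A - 1).mulVecLin) (LinearMap.range (A - 1).mulVecLin) := by
  obtain ⟨p, hp⟩ := exists_eq_mul_sq_of_squarefree h
  have hc : Commute (A - 1) (aeval A p) := by
    have : A - 1 = aeval A (X - C 1 : F[X]) := by simp
    rw [this]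
    rw [commute_iff_eq, ← map_mul, ← map_mul, mul_comm]
  set N := A - 1
  set Z := aeval A p
  constructor
  · rw [Submodule.disjoint_def]
    rintro _ hv ⟨w, rfl⟩
    simp only [LinearMap.mem_ker, mulVecLin_apply] at hv ⊢
    rw [hp, sq, ← mulVec_mulVec, ← mulVec_mulVec, hv, mulVec_zero]
  · rw [codisjoint_iff, eq_top_iff]
    intro v _
    refine Submodule.mem_sup.2 ⟨v - N *ᵥ Z *ᵥ v, ?_, N *ᵥ Z *ᵥ v, ⟨Z *ᵥ v, rfl⟩, by simp⟩
    have : N = N * N * Z := by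
      rw [← sq, (hc.pow_left 2).eq, ← hp]
    rw [LinearMap.mem_ker, mulVecLin_apply, mulVec_sub, mulVec_mulVec, mulVec_mulVec, ← this,
      sub_self]

lemma exists_conj_fromBlocks_one {x : Matrix (α ⊕ β) (α ⊕ β) F} (h : Squarefree (minpoly F x))
    (hr : (x - 1).rank = Fintype.card β) :
    ∃ (g : GL (α ⊕ β) F) (y : Matrix β β F), x * g.val = g.val * fromBlocks 1 0 0 y := by
  have hc := isCompl_ker_range_of_squarefree h
  set K := LinearMap.ker (x - 1).mulVecLin
  set R := LinearMap.range (x - 1).mulVecLin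
  have hR : Module.finrank F R = Fintype.card β := hr
  have hK : Module.finrank F K = Fintype.card α := by
    have := Submodule.finrank_add_eq_of_isCompl hc
    rw [Module.finrank_fintype_fun_eq_card, Fintype.card_sum] at this
    omega
  let bK : Module.Basis α F K :=
    (Module.finBasisOfFinrankEq F K hK).reindex (Fintype.equivFin α).symm
  let bR : Module.Basis β F R :=
    (Module.finBasisOfFinrankEq F R hR).reindex (Fintype.equivFin β).symm
  let b : Module.Basis (α ⊕ β) F (α ⊕ β → F) :=
    (bK.prod bR).map (Submodule.prodEquivOfIsCompl K R hc)
  have hbl (i) : b (Sum.inl i) = bK i := by simp [b]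
  have hbr (i) : b (Sum.inr i) = bR i := by simp [b]
  let P := (Pi.basisFun F (α ⊕ β)).toMatrix b
  let Q := b.toMatrix (Pi.basisFun F (α ⊕ β))
  let g : GL (α ⊕ β) F := ⟨P, Q, Module.Basis.toMatrix_mul_toMatrix_flip _ _,
    Module.Basis.toMatrix_mul_toMatrix_flip _ _⟩
  have hxR (v : R) : x *ᵥ (v : α ⊕ β → F) ∈ R := by
    have : x *ᵥ (v : α ⊕ β → F) = (x - 1).mulVecLin v + v := by
      simp
    rw [this]
    exact R.add_mem ⟨_, rfl⟩ v.2
  have hxK (v : K) : x *ᵥ (v : α ⊕ β → F) = v := by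
    have := v.2
    rw [LinearMap.mem_ker, mulVecLin_apply, sub_mulVec, one_mulVec, sub_eq_zero] at this
    exact this
  refine ⟨g, of fun i j => bR.repr ⟨x *ᵥ (bR j : α ⊕ β → F), hxR _⟩ i, ?_⟩
  have hg (i j) : g.val i j = b j i := by simp [g, P, Module.Basis.toMatrix_apply]
  have hx (i j) : (x * g.val) i j = (x *ᵥ b j) i := by
    simp [Matrix.mul_apply, mulVec, dotProduct, hg]
  ext i (j | j)
  · rw [hx, hbl, hxK, Matrix.mul_apply]
    simp [hg, hbl, Matrix.one_apply]
  · rw [hx, hbr, Matrix.mul_apply]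
    have := congrArg (fun v : R => (v : α ⊕ β → F) i)
      (bR.sum_repr ⟨x *ᵥ (bR j : α ⊕ β → F), hxR _⟩)
    simp only [Submodule.coe_sum, Finset.sum_apply] at this
    simp only [hg, hbl, hbr, Fintype.sum_sum_type, fromBlocks_apply₁₂, fromBlocks_apply₂₂,
      Matrix.zero_apply, mul_zero, Finset.sum_const_zero, zero_add, of_apply]
    rw [← this]
    simp [mul_comm]

/-- The block diagonal embedding `GL α × GL β → GL (α ⊕ β)`. -/
def blockDiagGL : GL α F × GL β F →* GL (α ⊕ β) F :=
  (Units.map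
    { toFun := fun p : Matrix α α F × Matrix β β F => fromBlocks p.1 0 0 p.2
      map_one' := fromBlocks_one
      map_mul' := fun p r => by simp [fromBlocks_multiply] }).comp
    MulEquiv.prodUnits.symm.toMonoidHom

@[simp] lemma val_blockDiagGL (p : GL α F × GL β F) :
    (blockDiagGL p).val = fromBlocks p.1.val 0 0 p.2.val := rfl

lemma blockDiagGL_injective :
    Function.Injective (blockDiagGL : GL α F × GL β F → GL (α ⊕ β) F) := by
  intro p r h
  have := congrArg Units.val h
  rw [val_blockDiagGL, val_blockDiagGL, fromBlocks_inj] at this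
  exact Prod.ext (Units.ext this.1) (Units.ext this.2.2.2)

lemma isUnit_blocks_of_isUnit_fromBlocks {A : Matrix α α F} {B : Matrix α β F}
    {D : Matrix β β F} (h : IsUnit (fromBlocks A B 0 D)) : IsUnit A ∧ IsUnit D := by
  rw [isUnit_iff_isUnit_det, det_fromBlocks_zero₂₁, IsUnit.mul_iff] at h
  exact ⟨(isUnit_iff_isUnit_det _).2 h.1, (isUnit_iff_isUnit_det _).2 h.2⟩

lemma exists_eq_blockDiagGL {k : GL (α ⊕ β) F} {y d : Matrix β β F} (hy : IsUnit (y - 1))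
    (hd : IsUnit (d - 1)) (h : fromBlocks 1 0 0 y * k.val = k.val * fromBlocks 1 0 0 d) :
    ∃ p, k = blockDiagGL p := by
  obtain ⟨A, B, C, D, hk⟩ : ∃ A B C D, k.val = fromBlocks A B C D :=
    ⟨_, _, _, _, (fromBlocks_toBlocks k.val).symm⟩
  rw [hk, fromBlocks_multiply, fromBlocks_multiply, fromBlocks_inj] at h
  simp only [Matrix.one_mul, Matrix.mul_one, Matrix.zero_mul, Matrix.mul_zero, add_zero,
    zero_add] at h
  obtain ⟨-, hB, hC, -⟩ := h
  have hB0 : B = 0 := by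
    obtain ⟨u, hu⟩ := hd
    have : B * u.val = 0 := by rw [hu, Matrix.mul_sub, ← hB, Matrix.mul_one, sub_self]
    rw [← Matrix.mul_one B, ← Units.val_one, ← mul_inv_cancel u, Units.val_mul, ← Matrix.mul_assoc,
      this, Matrix.zero_mul]
  have hC0 : C = 0 := by
    obtain ⟨u, hu⟩ := hy
    have : u.val * C = 0 := by rw [hu, Matrix.sub_mul, hC, Matrix.one_mul, sub_self]
    rw [← Matrix.one_mul C, ← Units.val_one, ← inv_mul_cancel u, Units.val_mul, Matrix.mul_assoc,
      this, Matrix.mul_zero]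
  subst hB0 hC0
  obtain ⟨⟨a, rfl⟩, ⟨b, rfl⟩⟩ := isUnit_blocks_of_isUnit_fromBlocks (hk ▸ k.isUnit)
  exact ⟨(a, b), Units.ext hk⟩

lemma rank_sub_one_of_conj_fromBlocks {x : Matrix (α ⊕ β) (α ⊕ β) F} {y : Matrix β β F}
    {g : GL (α ⊕ β) F} (h : x * g.val = g.val * fromBlocks 1 0 0 y) :
    (x - 1).rank = (y - 1).rank := by
  have hy : fromBlocks (1 : Matrix α α F) 0 0 y - 1 = fromBlocks 0 0 0 (y - 1) := by
    rw [← fromBlocks_one, sub_eq_iff_eq_add, fromBlocks_add]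
    simp
  have h2 : (x - 1) * g.val = g.val * fromBlocks 0 0 0 (y - 1) := by
    rw [← hy, Matrix.sub_mul, h, Matrix.mul_sub, Matrix.one_mul, Matrix.mul_one]
  have hg := (isUnit_iff_isUnit_det _).1 g.isUnit
  rw [← rank_mul_eq_left_of_isUnit_det g.val _ hg, h2, rank_mul_eq_right_of_isUnit_det g.val _ hg,
    rank_fromBlocks_zero_zero_zero]

lemma conj_blockDiagGL_mem (h : GL (α ⊕ β) F) {d : GL β F} (hd : Squarefree (minpoly F d.val))
    (hd' : IsUnit (d.val - 1)) :
    Squarefree (minpoly F (h * blockDiagGL (1, d) * h⁻¹).val) ∧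
      ((h * blockDiagGL (1, d) * h⁻¹).val - 1).rank = Fintype.card β := by
  have h1 : (h * blockDiagGL (1, d) * h⁻¹).val * h.val = h.val * fromBlocks 1 0 0 d.val := by
    rw [← Units.val_mul, inv_mul_cancel_right]; rfl
  refine ⟨(squarefree_minpoly_conj_iff h1).2 ((squarefree_minpoly_fromBlocks_iff _ _).2
    ⟨squarefree_minpoly_one, hd⟩), ?_⟩
  rw [rank_sub_one_of_conj_fromBlocks h1, (rank_eq_card_iff_isUnit _).2 hd']

lemma exists_eq_conj_blockDiagGL {x : GL (α ⊕ β) F} (hx : Squarefree (minpoly F x.val))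
    (hr : (x.val - 1).rank = Fintype.card β) :
    ∃ (g : GL (α ⊕ β) F) (y : GL β F), Squarefree (minpoly F y.val) ∧ IsUnit (y.val - 1) ∧
      x = g * blockDiagGL (1, y) * g⁻¹ := by
  obtain ⟨g, y, h⟩ := exists_conj_fromBlocks_one hx hr
  have hu : IsUnit (fromBlocks (1 : Matrix α α F) 0 0 y) := by
    have : fromBlocks (1 : Matrix α α F) 0 0 y = (g⁻¹ * x * g).val := by
      rw [mul_assoc, Units.val_mul, Units.val_mul, h, ← Matrix.mul_assoc, Units.inv_mul,
        Matrix.one_mul]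
    rw [this]
    exact Units.isUnit _
  obtain ⟨-, ⟨y, rfl⟩⟩ := isUnit_blocks_of_isUnit_fromBlocks hu
  refine ⟨g, y, ((squarefree_minpoly_fromBlocks_iff _ _).1
    ((squarefree_minpoly_conj_iff h).1 hx)).2, ?_, ?_⟩
  · rw [← rank_eq_card_iff_isUnit, ← hr, rank_sub_one_of_conj_fromBlocks h]
  · rw [eq_mul_inv_iff_mul_eq]
    exact Units.ext h

lemma card_squarefree_rank_mul :
    Nat.card {x : GL (α ⊕ β) F // Squarefree (minpoly F x.val) ∧
        (x.val - 1).rank = Fintype.card β} * (Nat.card (GL α F) * Nat.card (GL β F)) =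
      Nat.card (GL (α ⊕ β) F) *
        Nat.card {y : GL β F // Squarefree (minpoly F y.val) ∧ IsUnit (y.val - 1)} := by
  rw [← Nat.card_prod, ← Nat.card_prod, ← Nat.card_prod]
  choose g y hy hu hg using fun x : {x : GL (α ⊕ β) F // Squarefree (minpoly F x.val) ∧
    (x.val - 1).rank = Fintype.card β} => exists_eq_conj_blockDiagGL x.2.1 x.2.2
  have hconj (y b : GL β F) (a : GL α F) :
      blockDiagGL (a, b) * blockDiagGL (1, b⁻¹ * y * b) = blockDiagGL (1, y) * blockDiagGL (a, b) := by
    rw [← map_mul, ← map_mul]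
    simp [mul_assoc]
  have hconj' (y b : GL β F) : y.val * b.val = b.val * (b⁻¹ * y * b).val := by
    rw [← Units.val_mul, ← Units.val_mul]
    simp [mul_assoc]
  refine Nat.card_congr (Equiv.ofBijective (fun p => (g p.1 * blockDiagGL p.2,
    ⟨p.2.2⁻¹ * y p.1 * p.2.2, (squarefree_minpoly_conj_iff (hconj' _ _)).1 (hy _), ?_⟩)) ⟨?_, ?_⟩)
  · have : (p.2.2⁻¹ * y p.1 * p.2.2).val - 1 =
        (p.2.2⁻¹).val * ((y p.1).val - 1) * p.2.2.val := by
      simp [mul_sub, sub_mul, mul_assoc]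
    rw [this]
    exact ((Units.isUnit _).mul (hu _)).mul (Units.isUnit _)
  · rintro ⟨x, a, b⟩ ⟨x', a', b'⟩ h
    simp only [Prod.mk.injEq, Subtype.mk.injEq] at h
    obtain ⟨h1, h2⟩ := h
    have key (x : {x : GL (α ⊕ β) F // Squarefree (minpoly F x.val) ∧
        (x.val - 1).rank = Fintype.card β}) (a : GL α F) (b : GL β F) :
        x.1 = (g x * blockDiagGL (a, b)) * blockDiagGL (1, b⁻¹ * y x * b) *
          (g x * blockDiagGL (a, b))⁻¹ := by
      rw [mul_assoc (g x), hconj, ← mul_assoc, _root_.mul_inv_rev, ← mul_assoc, mul_inv_cancel_right]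
      exact hg x
    have hx : x = x' := Subtype.ext (by rw [key x a b, h1, h2, ← key x' a' b'])
    subst hx
    rw [blockDiagGL_injective (mul_left_cancel h1)]
  · rintro ⟨h, d, hd, hd'⟩
    let x : {x : GL (α ⊕ β) F // Squarefree (minpoly F x.val) ∧
      (x.val - 1).rank = Fintype.card β} := ⟨_, conj_blockDiagGL_mem h hd hd'⟩
    have hx : h * blockDiagGL (1, d) * h⁻¹ = g x * blockDiagGL (1, y x) * (g x)⁻¹ := hg x
    have hk : blockDiagGL (1, y x) * ((g x)⁻¹ * h) = ((g x)⁻¹ * h) * blockDiagGL (1, d) := by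
      rw [mul_inv_eq_iff_eq_mul] at hx
      rw [mul_assoc _ h, hx]
      group
    obtain ⟨⟨a, b⟩, hp⟩ := exists_eq_blockDiagGL (hu x) hd' (congrArg Units.val hk)
    refine ⟨(x, a, b), Prod.ext ?_ (Subtype.ext ?_)⟩
    · simp only
      rw [← hp, mul_inv_cancel_left]
    · rw [hp, ← hconj] at hk
      have := blockDiagGL_injective (mul_left_cancel hk)
      exact congrArg Prod.snd this

end Conjugation

section Affine

variable {F : Type*} [Field F] {β : Type*} [Fintype β] [DecidableEq β]

lemma fromBlocks_one_mul_shear (c : Matrix Unit β F) (M : Matrix β β F) :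
    fromBlocks 1 (c * (M - 1)) 0 M * fromBlocks 1 c 0 1 =
      (fromBlocks 1 c 0 1 * fromBlocks 1 0 0 M : Matrix (Unit ⊕ β) (Unit ⊕ β) F) := by
  simp [fromBlocks_multiply, Matrix.mul_sub]

lemma squarefree_minpoly_affine_iff (b : Matrix Unit β F) (M : Matrix β β F) :
    Squarefree (minpoly F (fromBlocks (1 : Matrix Unit Unit F) b 0 M)) ↔
      Squarefree (minpoly F M) ∧ ∃ c : Matrix Unit β F, c * (M - 1) = b := by
  constructor
  · intro h
    have hM : M * (fromCols 0 1 : Matrix β (Unit ⊕ β) F) =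
        (fromCols 0 1 : Matrix β (Unit ⊕ β) F) * fromBlocks 1 b 0 M := by
      rw [fromCols_mul_fromBlocks, mul_fromCols]
      simp
    refine ⟨squarefree_minpoly_of_right_inverse (Q := fromRows 0 1) hM
      (by simp [fromCols_mul_fromRows]) h, ?_⟩
    obtain ⟨p, hp⟩ := exists_eq_mul_sq_of_squarefree h
    have h1 : fromBlocks (1 : Matrix Unit Unit F) b 0 M - 1 = fromBlocks 0 b 0 (M - 1) := by
      rw [← fromBlocks_one, sub_eq_iff_eq_add, fromBlocks_add]
      simp
    obtain ⟨A, B, C, D, hZ⟩ : ∃ A B C D, aeval (fromBlocks (1 : Matrix Unit Unit F) b 0 M) p =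
        fromBlocks A B C D := ⟨_, _, _, _, (fromBlocks_toBlocks _).symm⟩
    rw [hZ, h1, sq, fromBlocks_multiply, fromBlocks_multiply, fromBlocks_inj] at hp
    refine ⟨A * b + B * (M - 1), ?_⟩
    conv_rhs => rw [hp.2.1]
    simp [Matrix.add_mul, Matrix.mul_assoc]
  · rintro ⟨hM, c, rfl⟩
    have h1 : (fromBlocks 1 c 0 1 : Matrix (Unit ⊕ β) (Unit ⊕ β) F) * fromBlocks 1 (-c) 0 1 = 1 := by
      simp [fromBlocks_multiply]
    refine squarefree_minpoly_of_right_inverse (fromBlocks_one_mul_shear c M) h1 ?_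
    exact (squarefree_minpoly_fromBlocks_iff _ _).2 ⟨squarefree_minpoly_one, hM⟩

/-- The index equivalence separating the first coordinate from the others. -/
def finSuccSumEquiv (n : ℕ) : Unit ⊕ Fin n ≃ Fin (n + 1) where
  toFun := Sum.elim (fun _ => 0) Fin.succ
  invFun := Fin.cases (Sum.inl ()) Sum.inr
  left_inv := by rintro (_ | _) <;> rfl
  right_inv i := by cases i using Fin.cases <;> rfl

/-- Simultaneous reindexing of rows and columns of invertible matrices. -/
def reindexGL {ι κ : Type*} [Fintype ι] [DecidableEq ι] [Fintype κ] [DecidableEq κ] (e : ι ≃ κ) :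
    GL ι F ≃* GL κ F :=
  Units.mapEquiv (reindexAlgEquiv F F e).toMulEquiv

lemma val_reindexGL {ι κ : Type*} [Fintype ι] [DecidableEq ι] [Fintype κ] [DecidableEq κ]
    (e : ι ≃ κ) (x : GL ι F) : (reindexGL e x).val = reindexAlgEquiv F F e x.val := rfl

lemma minpoly_reindexGL {ι κ : Type*} [Fintype ι] [DecidableEq ι] [Fintype κ] [DecidableEq κ]
    (e : ι ≃ κ) (x : GL ι F) : minpoly F (reindexGL e x).val = minpoly F x.val := by
  rw [val_reindexGL, minpoly.algEquiv_eq]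

lemma rank_reindexGL_sub_one {ι κ : Type*} [Fintype ι] [DecidableEq ι] [Fintype κ] [DecidableEq κ]
    (e : ι ≃ κ) (x : GL ι F) : ((reindexGL e x).val - 1).rank = (x.val - 1).rank := by
  rw [val_reindexGL, ← map_one (reindexAlgEquiv F F e), ← map_sub, coe_reindexAlgEquiv,
    rank_reindex]

/-- The affine transformation with translation row `b` and linear part `M`. -/
def affineGL (b : Matrix Unit β F) (M : GL β F) : GL (Unit ⊕ β) F where
  val := fromBlocks 1 b 0 M.val
  inv := fromBlocks 1 (-(b * (M⁻¹).val)) 0 (M⁻¹).val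
  val_inv := by simp [fromBlocks_multiply]
  inv_val := by simp [fromBlocks_multiply, Matrix.mul_assoc]

end Affine

section AffineFin

variable {F : Type} [Field F]

/-- The affine group is parametrized by translation rows and linear parts. -/
noncomputable def affineEquiv (n : ℕ) :
    Matrix Unit (Fin n) F × GL (Fin n) F ≃ {x : GL (Fin (n + 1)) F // IsAff x} :=
  Equiv.ofBijective
    (fun p => ⟨reindexGL (finSuccSumEquiv n) (affineGL p.1 p.2), by
      refine ⟨rfl, fun j hj => ?_⟩
      obtain ⟨j, rfl⟩ := Fin.exists_succ_eq.2 hj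
      rfl⟩)
    ⟨by
      rintro ⟨b, M⟩ ⟨b', M'⟩ h
      have := congrArg Units.val ((reindexGL (finSuccSumEquiv n)).injective (congrArg Subtype.val h))
      simp only [affineGL, fromBlocks_inj] at this
      exact Prod.ext this.2.1 (Units.ext this.2.2.2), by
      rintro ⟨x, hx⟩
      obtain ⟨x, rfl⟩ := (reindexGL (finSuccSumEquiv n)).surjective x
      obtain ⟨h1, h2⟩ := hx
      have hb : x.val = fromBlocks 1 x.val.toBlocks₁₂ 0 x.val.toBlocks₂₂ := by
        ext (i | i) (j | j)
        · exact h1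
        · rfl
        · exact h2 i.succ (Fin.succ_ne_zero i)
        · rfl
      obtain ⟨-, M, hM⟩ := isUnit_blocks_of_isUnit_fromBlocks (hb ▸ x.isUnit)
      refine ⟨(x.val.toBlocks₁₂, M), Subtype.ext (congrArg (reindexGL (finSuccSumEquiv n)) (Units.ext ?_))⟩
      rw [hb]
      simp only [affineGL, hM]
      rfl⟩

lemma minpoly_affineEquiv {n : ℕ} (p : Matrix Unit (Fin n) F × GL (Fin n) F) :
    minpoly F (affineEquiv n p).1.val = minpoly F (fromBlocks (1 : Matrix Unit Unit F) p.1 0 p.2.val) :=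
  minpoly_reindexGL _ _

variable [Fintype F]

lemma card_isAff (n : ℕ) : Nat.card {x : GL (Fin (n + 1)) F // IsAff x} =
    Fintype.card F ^ n * Nat.card (GL (Fin n) F) := by
  rw [← Nat.card_congr (affineEquiv n), Nat.card_prod]
  simp [Matrix]

open Classical in
lemma card_isAff_squarefree (n : ℕ) :
    Nat.card {x : GL (Fin (n + 1)) F // IsAff x ∧ Squarefree (minpoly F x.val)} =
      ∑ M : {M : GL (Fin n) F // Squarefree (minpoly F M.val)},
        Fintype.card F ^ (M.1.val - 1).rank := by
  let e : {x : GL (Fin (n + 1)) F // IsAff x ∧ Squarefree (minpoly F x.val)} ≃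
      Σ M : {M : GL (Fin n) F // Squarefree (minpoly F M.val)},
        {b : Matrix Unit (Fin n) F // ∃ c : Matrix Unit (Fin n) F, c * (M.1.val - 1) = b} :=
    calc {x : GL (Fin (n + 1)) F // IsAff x ∧ Squarefree (minpoly F x.val)}
      _ ≃ {x : {x : GL (Fin (n + 1)) F // IsAff x} // Squarefree (minpoly F x.1.val)} :=
        (Equiv.subtypeSubtypeEquivSubtypeInter IsAff
          fun x : GL (Fin (n + 1)) F => Squarefree (minpoly F x.val)).symm
      _ ≃ {p : Matrix Unit (Fin n) F × GL (Fin n) F //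
          Squarefree (minpoly F p.2.val) ∧ ∃ c : Matrix Unit (Fin n) F, c * (p.2.val - 1) = p.1} :=
        ((affineEquiv n).subtypeEquiv fun p => by
          rw [minpoly_affineEquiv, squarefree_minpoly_affine_iff]).symm
      _ ≃ _ :=
        { toFun := fun p => ⟨⟨p.1.2, p.2.1⟩, ⟨p.1.1, p.2.2⟩⟩
          invFun := fun s => ⟨(s.2.1, s.1.1), s.1.2, s.2.2⟩
          left_inv := fun _ => rfl
          right_inv := fun _ => rfl }
  rw [Nat.card_congr e, Nat.card_sigma]
  exact Finset.sum_congr rfl fun M _ => card_row_space _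

/-- The proportion of semisimple elements of `GL (Fin r) F` without eigenvalue `1`. -/
noncomputable def ssNoOne (F : Type) [Field F] (r : ℕ) : ℝ :=
  (Nat.card {y : GL (Fin r) F // Squarefree (minpoly F y.val) ∧ IsUnit (y.val - 1)} : ℝ) /
    Nat.card (GL (Fin r) F)

lemma card_GL_ne_zero (n : ℕ) : (Nat.card (GL (Fin n) F) : ℝ) ≠ 0 :=
  Nat.cast_ne_zero.2 Nat.card_pos.ne'

lemma card_squarefree_rank (k r : ℕ) :
    (Nat.card {x : GL (Fin (r + k)) F // Squarefree (minpoly F x.val) ∧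
      (x.val - 1).rank = r} : ℝ) =
    Nat.card (GL (Fin (r + k)) F) * (ssNoOne F r / Nat.card (GL (Fin k) F)) := by
  let e : Fin k ⊕ Fin r ≃ Fin (r + k) := (Equiv.sumComm _ _).trans finSumFinEquiv
  have h := card_squarefree_rank_mul (F := F) (α := Fin k) (β := Fin r)
  rw [Nat.card_congr (reindexGL (F := F) e).toEquiv,
    Nat.card_congr ((reindexGL (F := F) e).toEquiv.subtypeEquiv
      (q := fun x => Squarefree (minpoly F x.val) ∧ (x.val - 1).rank = r) fun x => by
        simp [minpoly_reindexGL, rank_reindexGL_sub_one])] at h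
  have h' := congrArg (Nat.cast : ℕ → ℝ) h
  push_cast at h'
  have h1 := card_GL_ne_zero (F := F) k
  have h2 := card_GL_ne_zero (F := F) r
  rw [ssNoOne]
  field_simp
  linear_combination h'

open Classical in
lemma sum_squarefree_rank (n : ℕ) (f : ℕ → ℝ) :
    ∑ M : {M : GL (Fin n) F // Squarefree (minpoly F M.val)}, f (M.1.val - 1).rank =
      Nat.card (GL (Fin n) F) * ∑ p ∈ Finset.HasAntidiagonal.antidiagonal n,
        ssNoOne F p.1 / Nat.card (GL (Fin p.2) F) * f p.1 := by
  rw [Finset.mul_sum, ← Finset.sum_fiberwise_of_maps_to (t := Finset.HasAntidiagonal.antidiagonal n)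
    (g := fun M => ((M.1.val - 1).rank, n - (M.1.val - 1).rank))]
  · refine Finset.sum_congr rfl ?_
    rintro ⟨r, k⟩ hrk
    obtain rfl := Finset.HasAntidiagonal.mem_antidiagonal.1 hrk
    rw [Finset.sum_congr rfl (g := fun _ => f r) fun M hM =>
      congrArg f (Prod.ext_iff.1 (Finset.mem_filter.1 hM).2).1, Finset.sum_const, nsmul_eq_mul,
      ← mul_assoc, ← card_squarefree_rank, ← Nat.card_congr
        (Equiv.subtypeSubtypeEquivSubtypeInter
          (fun x : GL (Fin (r + k)) F => Squarefree (minpoly F x.val))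
          fun x => (x.val - 1).rank = r), Nat.card_eq_fintype_card, Fintype.card_subtype]
    congr 3
    ext M
    simp only [Finset.mem_filter, Prod.mk.injEq]
    grind
  · intro M _
    have := rank_le_card_width (M.1.val - 1)
    rw [Fintype.card_fin] at this
    simp [this]

lemma ssGL_eq_sum (n : ℕ) : ssGL F n =
    ∑ p ∈ Finset.HasAntidiagonal.antidiagonal n, ssNoOne F p.1 * (1 / Nat.card (GL (Fin p.2) F)) := by
  classical
  have h := sum_squarefree_rank (F := F) n fun _ => 1
  rw [ssGL, Nat.card_eq_fintype_card (α := Subtype _), div_eq_iff (card_GL_ne_zero n), mul_comm]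
  simpa [div_eq_mul_inv] using h

lemma ssA_eq_sum (n : ℕ) : ssA F n =
    ∑ p ∈ Finset.HasAntidiagonal.antidiagonal n, ssNoOne F p.1 *
      (1 / ((Fintype.card F : ℝ) ^ p.2 * Nat.card (GL (Fin p.2) F))) := by
  classical
  have hq : (Fintype.card F : ℝ) ≠ 0 := Nat.cast_ne_zero.2 Fintype.card_ne_zero
  have h := sum_squarefree_rank (F := F) n fun r => (Fintype.card F : ℝ) ^ r
  rw [ssA, card_isAff, card_isAff_squarefree]
  push_cast
  rw [h, mul_comm, mul_div_mul_right _ _ (card_GL_ne_zero n), Finset.sum_div]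
  refine Finset.sum_congr rfl fun p hp => ?_
  rw [← Finset.HasAntidiagonal.mem_antidiagonal.1 hp, pow_add]
  have := card_GL_ne_zero (F := F) p.2
  field_simp

lemma card_GL_eq_qpoch (k : ℕ) : (Nat.card (GL (Fin k) F) : ℝ) =
    (Fintype.card F : ℝ) ^ (k ^ 2) * qpoch (Fintype.card F) k := by
  have hq : (Fintype.card F : ℝ) ≠ 0 := Nat.cast_ne_zero.2 Fintype.card_ne_zero
  rw [card_GL_field, Nat.cast_prod, Fin.prod_univ_eq_prod_range
    (fun i => ((Fintype.card F ^ k - Fintype.card F ^ i : ℕ) : ℝ)), qpoch,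
    ← Finset.prod_range_reflect, ← Finset.Ico_succ_right_eq_Icc, Order.succ_eq_add_one,
    Finset.prod_Ico_eq_prod_range, Nat.add_sub_cancel, sq, pow_mul]
  have hconst : ((Fintype.card F : ℝ) ^ k) ^ k = ∏ _j ∈ Finset.range k, (Fintype.card F : ℝ) ^ k := by
    simp
  rw [hconst, ← Finset.prod_mul_distrib]
  refine Finset.prod_congr rfl fun j hj => ?_
  obtain ⟨m, rfl⟩ : ∃ m, k = 1 + j + m := Nat.exists_eq_add_of_le (by grind)
  have hm : 1 + j + m - 1 - j = m := by omega
  rw [hm, Nat.cast_sub (Nat.pow_le_pow_right Fintype.card_pos (Nat.le_add_left _ _))]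
  push_cast
  rw [pow_add _ (1 + j) m]
  field_simp

end AffineFin

/-- The coefficientwise form of the generating function relation
`SS_A(u,q) Σ_k u^k/(q^{k²}(1/q)_k) = SS_GL(u,q) Σ_k u^k/(q^{k²+k}(1/q)_k)`:
for every `n ≥ 0`,
`Σ_{k=0}^n ss_A(n-k,q)/(q^{k²}(1/q)_k) = Σ_{k=0}^n ss_GL(n-k,q)/(q^{k²+k}(1/q)_k)`. -/
theorem semisimple_GL_affine_relation (F : Type) [Field F] [Fintype F] (q : ℕ)
    (hq : q = Fintype.card F) (n : ℕ) :
    ∑ k ∈ Finset.range (n + 1), ssA F (n - k) / ((q : ℝ) ^ (k ^ 2) * qpoch (q : ℝ) k) =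
      ∑ k ∈ Finset.range (n + 1),
        ssGL F (n - k) / ((q : ℝ) ^ (k ^ 2 + k) * qpoch (q : ℝ) k) := by
  subst hq
  have hA : PowerSeries.mk (ssA F) = PowerSeries.mk (ssNoOne F) *
      PowerSeries.mk fun k => 1 / ((Fintype.card F : ℝ) ^ k * Nat.card (GL (Fin k) F)) := by
    ext m
    simp only [PowerSeries.coeff_mul, PowerSeries.coeff_mk, ssA_eq_sum]
  have hG : PowerSeries.mk (ssGL F) = PowerSeries.mk (ssNoOne F) *
      PowerSeries.mk fun k => 1 / (Nat.card (GL (Fin k) F) : ℝ) := by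
    ext m
    simp only [PowerSeries.coeff_mul, PowerSeries.coeff_mk, ssGL_eq_sum]
  have h : (PowerSeries.mk fun k => 1 / (Nat.card (GL (Fin k) F) : ℝ)) * PowerSeries.mk (ssA F) =
      (PowerSeries.mk fun k => 1 / ((Fintype.card F : ℝ) ^ k * Nat.card (GL (Fin k) F))) *
        PowerSeries.mk (ssGL F) := by
    rw [hA, hG]
    ring
  have hn := congrArg (PowerSeries.coeff n) h
  simp only [PowerSeries.coeff_mul, PowerSeries.coeff_mk] at hn
  rw [Finset.Nat.sum_antidiagonal_eq_sum_range_succ_mk,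
    Finset.Nat.sum_antidiagonal_eq_sum_range_succ_mk] at hn
  convert hn using 2 with k _ k _
  · rw [card_GL_eq_qpoch, one_div, div_eq_inv_mul]
  · rw [card_GL_eq_qpoch, pow_add, one_div, div_eq_inv_mul]
    ring_nf
end
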